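/- For every natural number k with 0 ≤ k ≤ 99 there exists a homogeneous polynomial F of degree 7 in ℝ[x,y,z,w] such that the surface {F = 0} in ℙ³(ℂ) has exactly k singular points, every singular point is a node (ordinary double point), and every singular point can be represented by a nonzero vector with real coordinates. -/

import Mathlib

open MvPolynomial

/-- All partial derivatives of `F` vanish at `v`. -/
def VanishingJacobianAt (F : MvPolynomial (Fin 4) ℂ) (v : Fin 4 → ℂ) : Prop :=
  ∀ i, eval v (pderiv i F) = 0

/-- The Hessian matrix `(∂²F/∂xᵢ∂xⱼ)(v)`. -/
noncomputable def hessianAt (F : MvPolynomial (Fin 4) ℂ) (v : Fin 4 → ℂ) :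
    Matrix (Fin 4) (Fin 4) ℂ :=
  Matrix.of fun i j => eval v (pderiv i (pderiv j F))

/-- A point of ℙ³(ℂ) is a singular point of `{F = 0}` if it is represented by a
nonzero vector at which all four partial derivatives of `F` vanish. -/
def IsSingularPoint (F : MvPolynomial (Fin 4) ℂ)
    (p : Projectivization ℂ (Fin 4 → ℂ)) : Prop :=
  ∃ v : Fin 4 → ℂ, ∃ hv : v ≠ 0, Projectivization.mk ℂ v hv = p ∧
    VanishingJacobianAt F v

/-- A point of ℙ³(ℂ) is a node of `{F = 0}` if it is represented by a nonzero
vector at which all partial derivatives of `F` vanish and the 4×4 Hessian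
matrix has rank 3. -/
def IsNode (F : MvPolynomial (Fin 4) ℂ)
    (p : Projectivization ℂ (Fin 4 → ℂ)) : Prop :=
  ∃ v : Fin 4 → ℂ, ∃ hv : v ≠ 0, Projectivization.mk ℂ v hv = p ∧
    VanishingJacobianAt F v ∧ (hessianAt F v).rank = 3

/-- A point of ℙ³(ℂ) is real, i.e. representable by a nonzero vector with real
coordinates. -/
def IsRealPoint (p : Projectivization ℂ (Fin 4 → ℂ)) : Prop :=
  ∃ v : Fin 4 → ℂ, ∃ hv : v ≠ 0, Projectivization.mk ℂ v hv = p ∧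
    ∀ i, ∃ r : ℝ, v i = (r : ℂ)


section
open MvPolynomial

theorem eval_hasStrictFDerivAt {𝕜 : Type*} [NontriviallyNormedField 𝕜] (P : MvPolynomial (Fin 4) 𝕜)
    (v : Fin 4 → 𝕜) :
    HasStrictFDerivAt (fun u : Fin 4 → 𝕜 => eval u P)
      (∑ l, (eval v (pderiv l P)) • (ContinuousLinearMap.proj (R := 𝕜) (φ := fun _ : Fin 4 => 𝕜) l)) v := by
  induction P using MvPolynomial.induction_on with
  | C a =>
    simp only [eval_C]
    refine (hasStrictFDerivAt_const a v).congr_fderiv ?_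
    ext u
    simp
  | add p q hp hq =>
    simp only [map_add]
    refine (hp.fun_add hq).congr_fderiv ?_
    ext u
    simp [add_mul, Finset.sum_add_distrib]
  | mul_X p n hp =>
    have h1 : HasStrictFDerivAt (fun u : Fin 4 → 𝕜 => u n)
        (ContinuousLinearMap.proj (R := 𝕜) (φ := fun _ : Fin 4 => 𝕜) n) v :=
      (ContinuousLinearMap.proj (R := 𝕜) (φ := fun _ : Fin 4 => 𝕜) n).hasStrictFDerivAt
    have h2 := hp.mul h1
    simp only [map_mul, eval_X]
    refine h2.congr_fderiv ?_
    ext u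
    simp only [pderiv_mul, pderiv_X, map_add, map_mul, eval_X, add_apply,
      smul_apply, sum_apply, ContinuousLinearMap.proj_apply,
      smul_eq_mul, add_mul, Finset.sum_add_distrib, Pi.single_apply]
    rw [add_comm, Finset.mul_sum]
    congr 1
    · refine Finset.sum_congr rfl fun l _ => by ring
    · rw [Finset.sum_eq_single n]
      · simp
      · intro b _ hb; simp [hb.symm]
      · simp

/-- gradient of the family. -/
noncomputable def gfun {𝕜 : Type*} [Field 𝕜] {ι : Type*} [Fintype ι]
    (F : MvPolynomial (Fin 4) 𝕜) (G : ι → MvPolynomial (Fin 4) 𝕜) (t : ι → 𝕜) (v : Fin 4 → 𝕜)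
    (j : Fin 4) : 𝕜 :=
  eval v (pderiv j F) + ∑ k, t k * eval v (pderiv j (G k))

theorem gfun_hasStrictFDerivAt {𝕜 : Type*} [NontriviallyNormedField 𝕜] {ι : Type*} [Fintype ι]
    (F : MvPolynomial (Fin 4) 𝕜) (G : ι → MvPolynomial (Fin 4) 𝕜) (p : Fin 4 → 𝕜) :
    ∃ D : ((ι → 𝕜) × (Fin 4 → 𝕜)) →L[𝕜] (Fin 4 → 𝕜),
      HasStrictFDerivAt (fun a : (ι → 𝕜) × (Fin 4 → 𝕜) => gfun F G a.1 a.2) D (0, p) ∧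
      ∀ a j, D a j = ∑ l, eval p (pderiv l (pderiv j F)) * a.2 l +
        ∑ k, a.1 k * eval p (pderiv j (G k)) := by
  have key : ∀ j : Fin 4, ∃ D : ((ι → 𝕜) × (Fin 4 → 𝕜)) →L[𝕜] 𝕜,
      HasStrictFDerivAt (fun a : (ι → 𝕜) × (Fin 4 → 𝕜) => gfun F G a.1 a.2 j) D (0, p) ∧
      ∀ a, D a = ∑ l, eval p (pderiv l (pderiv j F)) * a.2 l +
        ∑ k, a.1 k * eval p (pderiv j (G k)) := by
    intro j
    have e1 : ∀ P : MvPolynomial (Fin 4) 𝕜, HasStrictFDerivAt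
        (fun a : (ι → 𝕜) × (Fin 4 → 𝕜) => eval a.2 P) _ (0, p) := fun P =>
      HasStrictFDerivAt.comp (g := fun u : Fin 4 → 𝕜 => eval u P)
        (f := fun a : (ι → 𝕜) × (Fin 4 → 𝕜) => a.2) (0, p) (eval_hasStrictFDerivAt P p)
        (hasStrictFDerivAt_snd (𝕜 := 𝕜) (E := ι → 𝕜) (F := Fin 4 → 𝕜) (p := ((0 : ι → 𝕜), p)))
    have e2 : ∀ k : ι, HasStrictFDerivAt (fun a : (ι → 𝕜) × (Fin 4 → 𝕜) => a.1 k)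
        ((ContinuousLinearMap.proj (R := 𝕜) (φ := fun _ : ι => 𝕜) k).comp
          (ContinuousLinearMap.fst 𝕜 (ι → 𝕜) (Fin 4 → 𝕜))) (0, p) := fun k =>
      ((ContinuousLinearMap.proj (R := 𝕜) (φ := fun _ : ι => 𝕜) k).comp
          (ContinuousLinearMap.fst 𝕜 (ι → 𝕜) (Fin 4 → 𝕜))).hasStrictFDerivAt
    have e3 := (e1 (pderiv j F)).fun_add
      (HasStrictFDerivAt.fun_sum (u := Finset.univ) fun k _ => (e2 k).mul (e1 (pderiv j (G k))))
    refine ⟨_, e3, fun a => ?_⟩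
    simp [mul_comm]
  choose D h1 h2 using key
  refine ⟨ContinuousLinearMap.pi D, ?_, fun a j => h2 j a⟩
  exact hasStrictFDerivAt_pi.2 h1

/-- local uniqueness -/
theorem local_unique {E V W : Type*} [NormedAddCommGroup E] [NormedSpace ℂ E]
    [NormedAddCommGroup V] [NormedSpace ℂ V] [FiniteDimensional ℂ V]
    [NormedAddCommGroup W] [NormedSpace ℂ W] (g : E × V → W) (D : E × V →L[ℂ] W) (p : V)
    (hg : HasStrictFDerivAt g D (0, p)) (hD : ∀ u : V, D (0, u) = 0 → u = 0) :
    ∃ U : Set V, IsOpen U ∧ p ∈ U ∧ ∀ᶠ t in nhds (0 : E), ∀ v ∈ U, ∀ v' ∈ U,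
      g (t, v) = g (t, v') → v = v' := by
  let D2 : V →L[ℂ] W := D.comp (ContinuousLinearMap.inr ℂ E V)
  have hker : LinearMap.ker (D2 : V →ₗ[ℂ] W) = ⊥ := by
    rw [LinearMap.ker_eq_bot']
    intro u hu
    exact hD u (by simpa [D2] using hu)
  obtain ⟨K, hK, hanti⟩ := (D2 : V →ₗ[ℂ] W).exists_antilipschitzWith hker
  have hK' : (0 : ℝ) < K := hK
  have ho := hg.isLittleO.def (show (0 : ℝ) < 1 / (2 * K) by positivity)
  rw [nhds_prod_eq, Filter.eventually_prod_iff] at ho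
  obtain ⟨pa, hpa, pb, hpb, hab⟩ := ho
  have hboth := hpa.and hpb
  rw [nhds_prod_eq, Filter.eventually_prod_iff] at hboth
  obtain ⟨qt, hqt, qv, hqv, hq⟩ := hboth
  obtain ⟨U, hU1, hU2, hU3⟩ := mem_nhds_iff.1 hqv
  refine ⟨U, hU2, hU3, ?_⟩
  filter_upwards [hqt] with t ht v hv v' hv' heq
  have h1 := hab (hq ht (hU1 hv)).1 (hq ht (hU1 hv')).2
  simp only [heq, sub_self, zero_sub, norm_neg, Prod.mk_sub_mk] at h1
  have h3 : D (0, v - v') = D2 (v - v') := by simp [D2]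
  have h4 : ‖v - v'‖ ≤ K * ‖D2 (v - v')‖ := by
    have := hanti.le_mul_dist (v - v') 0
    simpa using this
  rw [h3] at h1
  have h5 : ‖((0 : E), v - v')‖ = ‖v - v'‖ := by simp [Prod.norm_def]
  rw [h5] at h1
  have h6 : ‖v - v'‖ ≤ K * (1 / (2 * K) * ‖v - v'‖) := h4.trans (by gcongr)
  have h7 : (K : ℝ) * (1 / (2 * K) * ‖v - v'‖) = ‖v - v'‖ / 2 := by field_simp
  rw [h7] at h6
  have : ‖v - v'‖ = 0 := by linarith [norm_nonneg (v - v')]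
  exact sub_eq_zero.1 (norm_eq_zero.1 this)

end

section
open MvPolynomial

theorem eval_ofReal_map (P : MvPolynomial (Fin 4) ℝ) (v : Fin 4 → ℝ) :
    eval (fun j => (v j : ℂ)) (MvPolynomial.map (algebraMap ℝ ℂ) P) = ((eval v P : ℝ) : ℂ) := by
  induction P using MvPolynomial.induction_on with
  | C a => simp
  | add p q hp hq => simp [hp, hq]
  | mul_X p n hp => simp [hp]

theorem euler_eval {𝕜 : Type*} [Field 𝕜] {F : MvPolynomial (Fin 4) 𝕜} {n : ℕ}
    (hF : F.IsHomogeneous n) (v : Fin 4 → 𝕜) :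
    ∑ j, v j * eval v (pderiv j F) = n * eval v F := by
  have h := congrArg (eval v) hF.sum_X_mul_pderiv
  simpa [map_sum] using h

theorem euler_hess {𝕜 : Type*} [Field 𝕜] {F : MvPolynomial (Fin 4) 𝕜}
    (hF : F.IsHomogeneous 7) (v : Fin 4 → 𝕜) (l : Fin 4) :
    ∑ j, v j * eval v (pderiv l (pderiv j F)) = 6 * eval v (pderiv l F) := by
  have h := congrArg (fun P => eval v (pderiv l P)) hF.sum_X_mul_pderiv
  simp only [map_sum, pderiv_mul, pderiv_X, map_add, map_mul, eval_X, map_nsmul,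
    Finset.sum_add_distrib] at h
  rw [Finset.sum_eq_single l] at h
  · simp at h
    linear_combination h
  · intro b _ hb
    simp [hb]
  · simp

theorem eval_smul_homog {𝕜 : Type*} [Field 𝕜] {F : MvPolynomial (Fin 4) 𝕜} {n : ℕ}
    (hF : F.IsHomogeneous n) (v : Fin 4 → 𝕜) (c : 𝕜) :
    eval (c • v) F = c ^ n * eval v F := by
  rw [eval_eq, eval_eq, Finset.mul_sum]
  refine Finset.sum_congr rfl fun d hd => ?_
  have h := hF.degree_eq_sum_deg_support hd
  simp only [Pi.smul_apply, smul_eq_mul, mul_pow, Finset.prod_mul_distrib]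
  rw [Finset.prod_pow_eq_pow_sum]
  have h2 : ∑ i ∈ d.support, d i = n := h.symm
  rw [h2]; ring

/-- the map used for existence -/
noncomputable def psi {ι : Type*} [Fintype ι] (F : MvPolynomial (Fin 4) ℝ)
    (G : ι → MvPolynomial (Fin 4) ℝ) (p : ι → Fin 4 → ℝ)
    (a : (ι → ℝ) × (ι → Fin 4 → ℝ)) : ι → (Fin 4 → ℝ) × ℝ :=
  fun i => (gfun F G a.1 (a.2 i), ∑ j, p i j * a.2 i j)

theorem psi_map_nhds {ι : Type*} [Fintype ι] [DecidableEq ι] (F : MvPolynomial (Fin 4) ℝ)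
    (G : ι → MvPolynomial (Fin 4) ℝ) (p : ι → Fin 4 → ℝ) (hF : F.IsHomogeneous 7)
    (hG : ∀ k, (G k).IsHomogeneous 7) (hp2 : ∀ i, p i 2 = 1)
    (hsing : ∀ i j, eval (p i) (pderiv j F) = 0)
    (hnode : ∀ i (u : Fin 4 → ℝ), (∀ j, ∑ l, eval (p i) (pderiv l (pderiv j F)) * u l = 0) →
      ∃ c : ℝ, u = c • p i)
    (hGp : ∀ i k, eval (p i) (G k) = if k = i then 1 else 0) :
    Filter.map (psi F G p) (nhds (0, p)) = nhds (psi F G p (0, p)) := by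
  have hpp : ∀ i, 0 < ∑ j, p i j * p i j := fun i =>
    Finset.sum_pos' (fun j _ => mul_self_nonneg _) ⟨2, Finset.mem_univ _, by simp [hp2]⟩
  have key : ∀ i : ι, ∃ D : ((ι → ℝ) × (ι → Fin 4 → ℝ)) →L[ℝ] (Fin 4 → ℝ) × ℝ,
      HasStrictFDerivAt (fun a => psi F G p a i) D (0, p) ∧
      ∀ a, (∀ j, (D a).1 j = ∑ l, eval (p i) (pderiv l (pderiv j F)) * a.2 i l +
        ∑ k, a.1 k * eval (p i) (pderiv j (G k))) ∧ (D a).2 = ∑ j, p i j * a.2 i j := by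
    intro i
    obtain ⟨D, hD, hD2⟩ := gfun_hasStrictFDerivAt F G (p i)
    let A : ((ι → ℝ) × (ι → Fin 4 → ℝ)) →L[ℝ] (ι → ℝ) × (Fin 4 → ℝ) :=
      (ContinuousLinearMap.fst ℝ (ι → ℝ) (ι → Fin 4 → ℝ)).prod
        ((ContinuousLinearMap.proj (R := ℝ) (φ := fun _ : ι => Fin 4 → ℝ) i).comp
          (ContinuousLinearMap.snd ℝ (ι → ℝ) (ι → Fin 4 → ℝ)))
    let B : ((ι → ℝ) × (ι → Fin 4 → ℝ)) →L[ℝ] ℝ :=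
      (∑ j, p i j • (ContinuousLinearMap.proj (R := ℝ) (φ := fun _ : Fin 4 => ℝ) j)).comp
        ((ContinuousLinearMap.snd ℝ (ι → ℝ) (Fin 4 → ℝ)).comp A)
    have hA : HasStrictFDerivAt (fun a : (ι → ℝ) × (ι → Fin 4 → ℝ) => A a) A (0, p) :=
      A.hasStrictFDerivAt
    have hA0 : A (0, p) = (0, p i) := rfl
    have hB : HasStrictFDerivAt (fun a : (ι → ℝ) × (ι → Fin 4 → ℝ) => B a) B (0, p) :=
      B.hasStrictFDerivAt
    have h1 := HasStrictFDerivAt.comp (g := fun a : (ι → ℝ) × (Fin 4 → ℝ) => gfun F G a.1 a.2)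
      (f := fun a : (ι → ℝ) × (ι → Fin 4 → ℝ) => A a) (0, p) (by rw [hA0]; exact hD) hA
    have h2 := h1.prodMk hB
    refine ⟨(D.comp A).prod B, ?_, ?_⟩
    · have h3 : (fun a => psi F G p a i) = fun x => (gfun F G (A x).1 (A x).2, B x) := by
        funext a
        refine Prod.ext ?_ ?_
        · rfl
        · simp [psi, A, B]
      rw [h3]
      exact h2
    · intro a
      refine ⟨fun j => ?_, ?_⟩
      · exact hD2 (A a) j
      · simp [A, B]
  choose D h1 h2 using key
  have hstrict : HasStrictFDerivAt (psi F G p) (ContinuousLinearMap.pi D) (0, p) :=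
    hasStrictFDerivAt_pi.2 h1
  refine hstrict.map_nhds_eq_of_surj ?_
  rw [LinearMap.range_eq_top]
  have hdim : Module.finrank ℝ ((ι → ℝ) × (ι → Fin 4 → ℝ)) =
      Module.finrank ℝ (ι → (Fin 4 → ℝ) × ℝ) := by
    simp [Module.finrank_prod, Module.finrank_pi_fintype]
    ring
  refine (LinearMap.injective_iff_surjective_of_finrank_eq_finrank hdim).1 ?_
  rw [← LinearMap.ker_eq_bot, LinearMap.ker_eq_bot']
  intro a ha
  have hz : ∀ i, D i a = 0 := fun i => congrFun ha i
  have e1 : ∀ i j, ∑ l, eval (p i) (pderiv l (pderiv j F)) * a.2 i l +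
        ∑ k, a.1 k * eval (p i) (pderiv j (G k)) = 0 := fun i j => by
    rw [← (h2 i a).1 j, hz]; rfl
  have e2 : ∀ i, ∑ j, p i j * a.2 i j = 0 := fun i => by
    rw [← (h2 i a).2, hz]; rfl
  have ht : a.1 = 0 := by
    ext i
    have h3 : ∑ j, p i j * (∑ l, eval (p i) (pderiv l (pderiv j F)) * a.2 i l +
        ∑ k, a.1 k * eval (p i) (pderiv j (G k))) = 0 :=
      Finset.sum_eq_zero fun j _ => by rw [e1, mul_zero]
    have h4 : ∑ j, p i j * (∑ l, eval (p i) (pderiv l (pderiv j F)) * a.2 i l) = 0 := by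
      simp only [Finset.mul_sum]
      rw [Finset.sum_comm]
      refine Finset.sum_eq_zero fun l _ => ?_
      have := euler_hess hF (p i) l
      rw [hsing, mul_zero] at this
      have h5 : ∑ j, p i j * (eval (p i) (pderiv l (pderiv j F)) * a.2 i l) =
        (∑ j, p i j * eval (p i) (pderiv l (pderiv j F))) * a.2 i l := by
        rw [Finset.sum_mul]; refine Finset.sum_congr rfl fun j _ => by ring
      rw [h5, this, zero_mul]
    have h5 : ∑ j, p i j * (∑ k, a.1 k * eval (p i) (pderiv j (G k))) = 7 * a.1 i := by
      simp only [Finset.mul_sum]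
      rw [Finset.sum_comm]
      rw [Finset.sum_eq_single i]
      · have := euler_eval (hG i) (p i)
        rw [hGp] at this
        simp at this
        rw [← this, Finset.sum_mul]
        refine Finset.sum_congr rfl fun j _ => by ring
      · intro k _ hk
        have := euler_eval (hG k) (p i)
        rw [hGp, if_neg hk, mul_zero] at this
        have h6 : ∑ j, p i j * (a.1 k * eval (p i) (pderiv j (G k))) =
          a.1 k * ∑ j, p i j * eval (p i) (pderiv j (G k)) := by
          rw [Finset.mul_sum]; refine Finset.sum_congr rfl fun j _ => by ring
        rw [h6, this, mul_zero]
      · simp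
    simp only [mul_add, Finset.sum_add_distrib] at h3
    rw [h4, h5] at h3
    simp at h3
    simpa using h3
  have hv : a.2 = 0 := by
    ext i : 1
    obtain ⟨c, hc⟩ := hnode i (a.2 i) (fun j => by
      have := e1 i j
      simpa [ht] using this)
    have h6 := e2 i
    have h7 : c * ∑ j, p i j * p i j = 0 := by
      rw [← h6, hc, Finset.mul_sum]
      refine Finset.sum_congr rfl fun j _ => by simp; ring
    have : c = 0 := by
      rcases mul_eq_zero.1 h7 with h | h
      · exact h
      · exact absurd h (hpp i).ne'
    rw [hc, this]; simp
  exact Prod.ext ht hv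

end

section
open MvPolynomial

theorem interp_exists {ι : Type*} [Fintype ι] [DecidableEq ι] (p : ι → Fin 4 → ℝ)
    (hind : ∀ lam : ι → ℝ, (∀ G : MvPolynomial (Fin 4) ℝ, G.IsHomogeneous 7 →
      ∑ i, lam i * eval (p i) G = 0) → lam = 0) (k : ι) :
    ∃ G : MvPolynomial (Fin 4) ℝ, G.IsHomogeneous 7 ∧
      ∀ i, eval (p i) G = if k = i then 1 else 0 := by
  let L : homogeneousSubmodule (Fin 4) ℝ 7 →ₗ[ℝ] (ι → ℝ) :=
    LinearMap.pi fun i => (MvPolynomial.aeval (p i)).toLinearMap.comp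
      (homogeneousSubmodule (Fin 4) ℝ 7).subtype
  have hL : ∀ G i, L G i = eval (p i) G.1 := fun G i => by
    simp [L, MvPolynomial.aeval_eq_eval]
  have htop : LinearMap.range L = ⊤ := by
    by_contra hne
    obtain ⟨f, hf0, hf⟩ := Submodule.exists_le_ker_of_lt_top _ (lt_top_iff_ne_top.2 hne)
    apply hf0
    have h0 : (fun i => f (Pi.single i 1)) = 0 := by
      apply hind
      intro G hG
      have h1 : f (L ⟨G, hG⟩) = 0 := hf ⟨_, rfl⟩
      rw [LinearMap.pi_apply_eq_sum_univ] at h1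
      rw [← h1]
      refine Finset.sum_congr rfl fun i _ => ?_
      rw [hL, smul_eq_mul, mul_comm]
      have he : (Pi.single i 1 : ι → ℝ) = fun j => if i = j then 1 else 0 := by
        ext j; simp [Pi.single_apply, eq_comm]
      rw [he]
    ext i
    have := congrFun h0 i
    simpa using this
  have hmem : (fun i => if k = i then (1 : ℝ) else 0) ∈ LinearMap.range L := by
    rw [htop]; trivial
  obtain ⟨G, hG⟩ := hmem
  exact ⟨G.1, G.2, fun i => by rw [← hL, hG]⟩

theorem kappa_unique {ι : Type*} [Fintype ι] (F : MvPolynomial (Fin 4) ℂ)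
    (G : ι → MvPolynomial (Fin 4) ℂ) (p : Fin 4 → ℂ) (hF : F.IsHomogeneous 7)
    (hpp : ∑ j, p j * p j ≠ 0) (hsing : ∀ j, eval p (pderiv j F) = 0)
    (hnode : ∀ (u : Fin 4 → ℂ), (∀ j, ∑ l, eval p (pderiv l (pderiv j F)) * u l = 0) →
      ∃ c : ℂ, u = c • p) :
    ∃ U : Set (Fin 4 → ℂ), IsOpen U ∧ p ∈ U ∧ ∀ᶠ t in nhds (0 : ι → ℂ), ∀ v ∈ U, ∀ v' ∈ U,
      (∀ j, gfun F G t v j + (∑ l, p l * v l - ∑ l, p l * p l) * p j = 0) →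
      (∀ j, gfun F G t v' j + (∑ l, p l * v' l - ∑ l, p l * p l) * p j = 0) → v = v' := by
  obtain ⟨D, hD, hD2⟩ := gfun_hasStrictFDerivAt F G p
  let B : ((ι → ℂ) × (Fin 4 → ℂ)) →L[ℂ] (Fin 4 → ℂ) :=
    ((∑ j, p j • (ContinuousLinearMap.proj (R := ℂ) (φ := fun _ : Fin 4 => ℂ) j)).comp
      (ContinuousLinearMap.snd ℂ (ι → ℂ) (Fin 4 → ℂ))).smulRight p
  have hB : ∀ a j, B a j = (∑ l, p l * a.2 l) * p j := fun a j => by simp [B]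
  have h1 := hD.fun_add (B.hasStrictFDerivAt (x := ((0 : ι → ℂ), p)))
  obtain ⟨U, hU, hpU, hev⟩ := local_unique _ _ p h1 (by
    intro u hu
    have e1 : ∀ j, ∑ l, eval p (pderiv l (pderiv j F)) * u l + (∑ l, p l * u l) * p j = 0 := by
      intro j
      have := congrFun hu j
      simp only [add_apply, Pi.add_apply, hD2, hB] at this
      simpa using this
    have h4 : ∑ j, p j * (∑ l, eval p (pderiv l (pderiv j F)) * u l) = 0 := by
      simp only [Finset.mul_sum]
      rw [Finset.sum_comm]
      refine Finset.sum_eq_zero fun l _ => ?_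
      have := euler_hess hF p l
      rw [hsing, mul_zero] at this
      have h5 : ∑ j, p j * (eval p (pderiv l (pderiv j F)) * u l) =
        (∑ j, p j * eval p (pderiv l (pderiv j F))) * u l := by
        rw [Finset.sum_mul]; refine Finset.sum_congr rfl fun j _ => by ring
      rw [h5, this, zero_mul]
    have h5 : ∑ j, p j * (∑ l, eval p (pderiv l (pderiv j F)) * u l + (∑ l, p l * u l) * p j)
        = 0 := Finset.sum_eq_zero fun j _ => by rw [e1, mul_zero]
    simp only [mul_add, Finset.sum_add_distrib] at h5
    rw [h4, zero_add] at h5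
    have h6 : ∑ j, p j * ((∑ l, p l * u l) * p j) = (∑ l, p l * u l) * ∑ j, p j * p j := by
      rw [Finset.mul_sum]; refine Finset.sum_congr rfl fun j _ => by ring
    rw [h6] at h5
    have h7 : ∑ l, p l * u l = 0 := (mul_eq_zero.1 h5).resolve_right hpp
    obtain ⟨c, hc⟩ := hnode u (fun j => by simpa [h7] using e1 j)
    have h8 : c * ∑ j, p j * p j = 0 := by
      rw [← h7, hc, Finset.mul_sum]
      refine Finset.sum_congr rfl fun j _ => by simp; ring
    have h9 : c = 0 := (mul_eq_zero.1 h8).resolve_right hpp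
    rw [hc, h9, zero_smul])
  refine ⟨U, hU, hpU, ?_⟩
  filter_upwards [hev] with t ht v hv v' hv' e1 e2
  refine ht v hv v' hv' ?_
  ext j
  simp only [Pi.add_apply, hB]
  linear_combination e1 j - e2 j

theorem node_nbhd {ι : Type*} [Fintype ι] (F : MvPolynomial (Fin 4) ℂ)
    (G : ι → MvPolynomial (Fin 4) ℂ) (p : Fin 4 → ℂ) (hF : F.IsHomogeneous 7)
    (hpp : ∑ j, p j * p j ≠ 0) (hsing : ∀ j, eval p (pderiv j F) = 0)
    (hnode : ∀ (u : Fin 4 → ℂ), (∀ j, ∑ l, eval p (pderiv l (pderiv j F)) * u l = 0) →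
      ∃ c : ℂ, u = c • p) :
    ∀ᶠ a in nhds ((0 : ι → ℂ), p),
      (hessianAt (F + ∑ k, C (a.1 k) * G k) a.2 + Matrix.vecMulVec p p).det ≠ 0 := by
  have hc : Continuous fun a : (ι → ℂ) × (Fin 4 → ℂ) =>
      (hessianAt (F + ∑ k, C (a.1 k) * G k) a.2 + Matrix.vecMulVec p p).det := by
    apply Continuous.matrix_det
    refine Continuous.add ?_ continuous_const
    refine continuous_matrix fun i j => ?_
    simp only [hessianAt, Matrix.of_apply, map_add, map_sum, pderiv_C_mul, map_mul, eval_C]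
    have he : ∀ P : MvPolynomial (Fin 4) ℂ,
        Continuous fun a : (ι → ℂ) × (Fin 4 → ℂ) => eval a.2 P := fun P =>
      (MvPolynomial.continuous_eval P).comp continuous_snd
    refine (he _).add (continuous_finsetSum _ fun k _ => ?_)
    exact ((continuous_apply k).comp continuous_fst).mul (he _)
  refine hc.continuousAt.eventually_ne ?_
  simp only [Pi.zero_apply, map_zero, zero_mul, Finset.sum_const_zero, add_zero]
  intro hdet
  obtain ⟨u, hu0, hu⟩ := Matrix.exists_vecMul_eq_zero_iff.2 hdet
  apply hu0
  have e1 : ∀ j, ∑ l, eval p (pderiv l (pderiv j F)) * u l + (∑ l, p l * u l) * p j = 0 := by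
    intro j
    have := congrFun hu j
    simp only [Matrix.vecMul, dotProduct, hessianAt, Matrix.add_apply, Matrix.of_apply,
      Matrix.vecMulVec_apply, Pi.zero_apply] at this
    rw [← this, Finset.sum_mul, ← Finset.sum_add_distrib]
    refine Finset.sum_congr rfl fun l _ => by ring
  have h4 : ∑ j, p j * (∑ l, eval p (pderiv l (pderiv j F)) * u l) = 0 := by
    simp only [Finset.mul_sum]
    rw [Finset.sum_comm]
    refine Finset.sum_eq_zero fun l _ => ?_
    have := euler_hess hF p l
    rw [hsing, mul_zero] at this
    have h5 : ∑ j, p j * (eval p (pderiv l (pderiv j F)) * u l) =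
      (∑ j, p j * eval p (pderiv l (pderiv j F))) * u l := by
      rw [Finset.sum_mul]; refine Finset.sum_congr rfl fun j _ => by ring
    rw [h5, this, zero_mul]
  have h5 : ∑ j, p j * (∑ l, eval p (pderiv l (pderiv j F)) * u l + (∑ l, p l * u l) * p j)
      = 0 := Finset.sum_eq_zero fun j _ => by rw [e1, mul_zero]
  simp only [mul_add, Finset.sum_add_distrib] at h5
  rw [h4, zero_add] at h5
  have h6 : ∑ j, p j * ((∑ l, p l * u l) * p j) = (∑ l, p l * u l) * ∑ j, p j * p j := by
    rw [Finset.mul_sum]; refine Finset.sum_congr rfl fun j _ => by ring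
  rw [h6] at h5
  have h7 : ∑ l, p l * u l = 0 := (mul_eq_zero.1 h5).resolve_right hpp
  obtain ⟨c, hc⟩ := hnode u (fun j => by simpa [h7] using e1 j)
  have h8 : c * ∑ j, p j * p j = 0 := by
    rw [← h7, hc, Finset.mul_sum]
    refine Finset.sum_congr rfl fun j _ => by simp; ring
  have h9 : c = 0 := (mul_eq_zero.1 h8).resolve_right hpp
  rw [hc, h9, zero_smul]

theorem rank_three {F : MvPolynomial (Fin 4) ℂ} (hF : F.IsHomogeneous 7) (p q : Fin 4 → ℂ)
    (hq : q ≠ 0) (hsing : ∀ j, eval q (pderiv j F) = 0)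
    (hdet : (hessianAt F q + Matrix.vecMulVec p p).det ≠ 0) : (hessianAt F q).rank = 3 := by
  have hz : (hessianAt F q).mulVec q = 0 := by
    ext i
    simp only [Matrix.mulVec, dotProduct, hessianAt, Matrix.of_apply, Pi.zero_apply]
    have := euler_hess hF q i
    rw [hsing, mul_zero] at this
    rw [← this]
    refine Finset.sum_congr rfl fun l _ => by ring
  have hM : ∀ u, (hessianAt F q).mulVec u = 0 →
      (hessianAt F q + Matrix.vecMulVec p p).mulVec u = (p ⬝ᵥ u) • p := by
    intro u hu
    rw [Matrix.add_mulVec, hu, zero_add, Matrix.vecMulVec_mulVec]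
    ext i; simp [mul_comm]
  have hinj : ∀ u, (hessianAt F q + Matrix.vecMulVec p p).mulVec u = 0 → u = 0 := by
    intro u hu
    by_contra h0
    exact hdet (Matrix.exists_mulVec_eq_zero_iff.1 ⟨u, h0, hu⟩)
  have hpq : p ⬝ᵥ q ≠ 0 := by
    intro h
    exact hq (hinj q (by rw [hM q hz, h, zero_smul]))
  have hker : Module.finrank ℂ (LinearMap.ker (hessianAt F q).mulVecLin) = 1 := by
    refine (finrank_eq_one_iff_of_nonzero' (⟨q, by simpa using hz⟩ :
      LinearMap.ker (hessianAt F q).mulVecLin) (by simpa using hq)).2 ?_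
    rintro ⟨u, hu⟩
    have hu' : (hessianAt F q).mulVec u = 0 := by simpa using hu
    refine ⟨(p ⬝ᵥ u) / (p ⬝ᵥ q), ?_⟩
    ext1
    have h3 := hinj ((p ⬝ᵥ q) • u - (p ⬝ᵥ u) • q) (by
      rw [Matrix.mulVec_sub, Matrix.mulVec_smul, Matrix.mulVec_smul, hM u hu', hM q hz,
        smul_smul, smul_smul, mul_comm, sub_self])
    have h4 := sub_eq_zero.1 h3
    show ((p ⬝ᵥ u) / (p ⬝ᵥ q)) • q = u
    rw [div_eq_inv_mul, ← smul_smul, ← h4, smul_smul, inv_mul_cancel₀ hpq, one_smul]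
  have h5 := LinearMap.finrank_range_add_finrank_ker (hessianAt F q).mulVecLin
  rw [hker] at h5
  simp only [Module.finrank_fin_fun] at h5
  show Module.finrank ℂ (LinearMap.range (hessianAt F q).mulVecLin) = 3
  omega

end

section
open MvPolynomial

/-- complexification of a real vector -/
noncomputable def cvec (v : Fin 4 → ℝ) : Fin 4 → ℂ := fun j => (v j : ℂ)

theorem eval_cvec (P : MvPolynomial (Fin 4) ℝ) (v : Fin 4 → ℝ) :
    eval (cvec v) (MvPolynomial.map (algebraMap ℝ ℂ) P) = ((eval v P : ℝ) : ℂ) :=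
  eval_ofReal_map P v

theorem gfun_ofReal {ι : Type*} [Fintype ι] (F : MvPolynomial (Fin 4) ℝ)
    (G : ι → MvPolynomial (Fin 4) ℝ) (t : ι → ℝ) (v : Fin 4 → ℝ) (j : Fin 4) :
    gfun (MvPolynomial.map (algebraMap ℝ ℂ) F) (fun k => MvPolynomial.map (algebraMap ℝ ℂ) (G k))
      (fun k => (t k : ℂ)) (cvec v) j = ((gfun F G t v j : ℝ) : ℂ) := by
  simp only [gfun, pderiv_map, eval_cvec]
  push_cast
  rfl

theorem gfun_eq {𝕜 : Type*} [Field 𝕜] {ι : Type*} [Fintype ι] (F : MvPolynomial (Fin 4) 𝕜)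
    (G : ι → MvPolynomial (Fin 4) 𝕜) (t : ι → 𝕜) (v : Fin 4 → 𝕜) (j : Fin 4) :
    eval v (pderiv j (F + ∑ k, C (t k) * G k)) = gfun F G t v j := by
  simp only [gfun, map_add, map_sum, pderiv_C_mul, map_mul, eval_C]

theorem gfun_continuous {ι : Type*} [Fintype ι] (F : MvPolynomial (Fin 4) ℂ)
    (G : ι → MvPolynomial (Fin 4) ℂ) (j : Fin 4) :
    Continuous fun a : (ι → ℂ) × (Fin 4 → ℂ) => gfun F G a.1 a.2 j := by
  have he : ∀ P : MvPolynomial (Fin 4) ℂ,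
      Continuous fun a : (ι → ℂ) × (Fin 4 → ℂ) => eval a.2 P := fun P =>
    (MvPolynomial.continuous_eval P).comp continuous_snd
  refine (he _).add (continuous_finsetSum _ fun k _ => ?_)
  exact ((continuous_apply k).comp continuous_fst).mul (he _)

theorem nbhd_compact {ι : Type*} [Fintype ι] (F : MvPolynomial (Fin 4) ℂ)
    (G : ι → MvPolynomial (Fin 4) ℂ) (p : ι → Fin 4 → ℂ)
    (hpp : ∀ i, ∑ j, p i j * p i j ≠ 0)
    (hall : ∀ v : Fin 4 → ℂ, v ≠ 0 → (∀ j, eval v (pderiv j F) = 0) →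
      ∃ i, ∃ c : ℂ, v = c • p i)
    (U : ι → Set (Fin 4 → ℂ)) (hU : ∀ i, IsOpen (U i)) (hpU : ∀ i, p i ∈ U i) :
    ∀ᶠ t in nhds (0 : ι → ℂ), ∀ v ∈ Metric.sphere (0 : Fin 4 → ℂ) 1,
      (∀ j, gfun F G t v j = 0) → ∃ i, (∑ j, p i j * v j ≠ 0) ∧
        ((∑ j, p i j * p i j) / (∑ j, p i j * v j)) • v ∈ U i := by
  refine IsCompact.eventually_forall_of_forall_eventually (isCompact_sphere 0 1) ?_
  intro v hv
  by_cases h : ∀ j, gfun F G 0 v j = 0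
  · have hv0 : v ≠ 0 := by
      rintro rfl
      simp at hv
    obtain ⟨i, c, hc⟩ := hall v hv0 (fun j => by simpa [gfun] using h j)
    have hc0 : c ≠ 0 := by
      rintro rfl
      exact hv0 (by simpa using hc)
    have hlin : Continuous fun v : Fin 4 → ℂ => ∑ j, p i j * v j := by fun_prop
    have hpv : ∑ j, p i j * v j = c * ∑ j, p i j * p i j := by
      rw [hc, Finset.mul_sum]
      refine Finset.sum_congr rfl fun j _ => by simp; ring
    have hne : ∑ j, p i j * v j ≠ 0 := by
      rw [hpv]; exact mul_ne_zero hc0 (hpp i)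
    have e1 : ∀ᶠ u in nhds v, ∑ j, p i j * u j ≠ 0 := hlin.continuousAt.eventually_ne hne
    have e2 : ContinuousAt
        (fun u : Fin 4 → ℂ => ((∑ j, p i j * p i j) / (∑ j, p i j * u j)) • u) v :=
      (continuousAt_const.div hlin.continuousAt hne).smul continuousAt_id
    have e3 : ((∑ j, p i j * p i j) / (∑ j, p i j * v j)) • v = p i := by
      rw [hpv, hc, smul_smul]
      have := hpp i
      generalize ∑ j, p i j * p i j = s at this
      rw [show s / (c * s) * c = 1 by field_simp, one_smul]
    have e4 := e2.eventually_mem (by rw [e3]; exact (hU i).mem_nhds (hpU i))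
    have e5 : ∀ᶠ z in nhds ((0 : ι → ℂ), v), z.2 ∈ {u : Fin 4 → ℂ | ∑ j, p i j * u j ≠ 0 ∧
        ((∑ j, p i j * p i j) / (∑ j, p i j * u j)) • u ∈ U i} :=
      continuous_snd.continuousAt.eventually (p := fun u => u ∈ {u : Fin 4 → ℂ |
        ∑ j, p i j * u j ≠ 0 ∧
        ((∑ j, p i j * p i j) / (∑ j, p i j * u j)) • u ∈ U i}) (e1.and e4)
    filter_upwards [e5] with z hz _
    exact ⟨i, hz⟩
  · push Not at h
    obtain ⟨j, hj⟩ := h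
    have := (gfun_continuous F G j).continuousAt.eventually_ne
      (x := ((0 : ι → ℂ), v)) hj
    filter_upwards [this] with z hz h2
    exact absurd (h2 j) hz

theorem partA {ι : Type*} [Fintype ι] [DecidableEq ι] (F : MvPolynomial (Fin 4) ℝ)
    (p : ι → Fin 4 → ℝ) (hF : F.IsHomogeneous 7) (hp2 : ∀ i, p i 2 = 1)
    (hsing : ∀ i j, eval (p i) (pderiv j F) = 0)
    (hnode : ∀ i (u : Fin 4 → ℂ),
      (∀ j, ∑ l, ((eval (p i) (pderiv l (pderiv j F)) : ℝ) : ℂ) * u l = 0) →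
      ∃ c : ℂ, u = c • cvec (p i))
    (hall : ∀ v : Fin 4 → ℂ, v ≠ 0 →
      (∀ j, eval v (pderiv j (MvPolynomial.map (algebraMap ℝ ℂ) F)) = 0) →
      ∃ i, ∃ c : ℂ, v = c • cvec (p i))
    (hind : ∀ lam : ι → ℝ, (∀ G : MvPolynomial (Fin 4) ℝ, G.IsHomogeneous 7 →
      ∑ i, lam i * eval (p i) G = 0) → lam = 0) (S : Finset ι) :
    ∃ F : MvPolynomial (Fin 4) ℝ, F.IsHomogeneous 7 ∧
      {p : Projectivization ℂ (Fin 4 → ℂ) |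
          IsSingularPoint (MvPolynomial.map (algebraMap ℝ ℂ) F) p}.ncard = S.card ∧
      (∀ p : Projectivization ℂ (Fin 4 → ℂ),
        IsSingularPoint (MvPolynomial.map (algebraMap ℝ ℂ) F) p →
          IsNode (MvPolynomial.map (algebraMap ℝ ℂ) F) p) ∧
      (∀ p : Projectivization ℂ (Fin 4 → ℂ),
        IsSingularPoint (MvPolynomial.map (algebraMap ℝ ℂ) F) p →
          IsRealPoint p) := by
  choose G hG hGp using interp_exists p hind
  have hpinj : Function.Injective p := by
    intro i i' h
    by_contra hne
    have h1 := hGp i i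
    rw [h, hGp] at h1
    simp [hne] at h1
  have hppR : ∀ i, 0 < ∑ j, p i j * p i j := fun i =>
    Finset.sum_pos' (fun j _ => mul_self_nonneg _) ⟨2, Finset.mem_univ _, by simp [hp2]⟩
  have hppc : ∀ i, ∑ j, cvec (p i) j * cvec (p i) j = ((∑ j, p i j * p i j : ℝ) : ℂ) := by
    intro i; simp [cvec]
  have hpp : ∀ i, ∑ j, cvec (p i) j * cvec (p i) j ≠ 0 := by
    intro i; rw [hppc]; exact_mod_cast (hppR i).ne'
  set Fc := MvPolynomial.map (algebraMap ℝ ℂ) F with hFc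
  set Gc : ι → MvPolynomial (Fin 4) ℂ := fun k => MvPolynomial.map (algebraMap ℝ ℂ) (G k) with hGc
  have hFch : Fc.IsHomogeneous 7 := hF.map _
  have hsingc : ∀ i j, eval (cvec (p i)) (pderiv j Fc) = 0 := by
    intro i j
    simp only [hFc, pderiv_map, eval_cvec, hsing]; simp
  have hnodec : ∀ i (u : Fin 4 → ℂ),
      (∀ j, ∑ l, eval (cvec (p i)) (pderiv l (pderiv j Fc)) * u l = 0) →
      ∃ c : ℂ, u = c • cvec (p i) := by
    intro i u hu
    refine hnode i u fun j => ?_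
    have := hu j
    simpa only [hFc, pderiv_map, eval_cvec] using this
  have hnodeR : ∀ i (u : Fin 4 → ℝ),
      (∀ j, ∑ l, eval (p i) (pderiv l (pderiv j F)) * u l = 0) → ∃ c : ℝ, u = c • p i := by
    intro i u hu
    obtain ⟨c, hc⟩ := hnode i (cvec u) (fun j => by
      have := hu j
      simp only [cvec]
      exact_mod_cast this)
    refine ⟨c.re, ?_⟩
    ext j
    have := congrArg Complex.re (congrFun hc j)
    simpa [cvec] using this
  choose U hUo hpU hUev using fun i => kappa_unique Fc Gc (cvec (p i)) hFch (hpp i) (hsingc i)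
    (hnodec i)
  have hcomp := nbhd_compact Fc Gc (fun i => cvec (p i)) hpp hall U hUo hpU
  have hdet := fun i => node_nbhd Fc Gc (cvec (p i)) hFch (hpp i) (hsingc i) (hnodec i)
  -- transfer to the real parameter space
  have ct : Continuous fun a : (ι → ℝ) × (ι → Fin 4 → ℝ) => (fun k => ((a.1 k : ℝ) : ℂ)) := by
    fun_prop
  have cq : ∀ i, Continuous fun a : (ι → ℝ) × (ι → Fin 4 → ℝ) => cvec (a.2 i) := by
    intro i; unfold cvec; fun_prop
  have ct0 : (fun k => (((0 : ι → ℝ) k : ℝ) : ℂ)) = 0 := by ext; simp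
  have E1 : ∀ᶠ a in nhds ((0 : ι → ℝ), p), _ :=
    (ct.tendsto' _ _ ct0).eventually (Filter.eventually_all.2 hUev)
  have E2 : ∀ᶠ a in nhds ((0 : ι → ℝ), p), _ := (ct.tendsto' _ _ ct0).eventually hcomp
  have E3 : ∀ᶠ a in nhds ((0 : ι → ℝ), p), ∀ i, cvec (a.2 i) ∈ U i :=
    Filter.eventually_all.2 fun i =>
      (cq i).continuousAt.eventually_mem ((hUo i).mem_nhds (hpU i))
  have E4 : ∀ᶠ a in nhds ((0 : ι → ℝ), p), ∀ i,
      (hessianAt (Fc + ∑ k, C ((a.1 k : ℝ) : ℂ) * Gc k) (cvec (a.2 i)) +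
        Matrix.vecMulVec (cvec (p i)) (cvec (p i))).det ≠ 0 :=
    Filter.eventually_all.2 fun i =>
      ((ct.prodMk (cq i)).tendsto' ((0 : ι → ℝ), p) _ (by rw [ct0])).eventually (hdet i)
  have E5 : ∀ᶠ a in nhds ((0 : ι → ℝ), p), ∀ i, a.2 i 2 ≠ 0 :=
    Filter.eventually_all.2 fun i => by
      have : Continuous fun a : (ι → ℝ) × (ι → Fin 4 → ℝ) => a.2 i 2 := by fun_prop
      exact this.continuousAt.eventually_ne (by simp [hp2])
  have E6 : ∀ᶠ a in nhds ((0 : ι → ℝ), p), ∀ i i', i ≠ i' →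
      ∃ j, a.2 i j * a.2 i' 2 ≠ a.2 i 2 * a.2 i' j := by
    refine Filter.eventually_all.2 fun i => Filter.eventually_all.2 fun i' => ?_
    by_cases hii : i = i'
    · exact Filter.Eventually.of_forall fun a h => absurd hii h
    have : p i ≠ p i' := fun h => hii (hpinj h)
    obtain ⟨j, hj⟩ := Function.ne_iff.1 this
    have c1 : Continuous fun a : (ι → ℝ) × (ι → Fin 4 → ℝ) =>
      a.2 i j * a.2 i' 2 - a.2 i 2 * a.2 i' j := by fun_prop
    have := c1.continuousAt.eventually_ne (x := ((0 : ι → ℝ), p)) (y := 0)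
      (by simpa [hp2, sub_eq_zero] using hj)
    filter_upwards [this] with a ha _
    exact ⟨j, sub_ne_zero.1 ha⟩
  have hmap := psi_map_nhds F G p hF hG hp2 hsing hnodeR (fun i k => hGp k i)
  have Eall := ((((E1.and E2).and E3).and E4).and E5).and E6
  have himg := Filter.image_mem_map (m := psi F G p) Eall
  rw [hmap] at himg
  let y : ℝ → ι → (Fin 4 → ℝ) × ℝ := fun e i =>
    if i ∈ S then (0, ∑ j, p i j * p i j) else (e • p i, ∑ j, p i j * p i j - e)
  have hy : Continuous y := by
    refine continuous_pi fun i => ?_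
    by_cases h : i ∈ S
    · simp only [y, h, if_true]; exact continuous_const
    · simp only [y, h, if_false]; fun_prop
  have hy0 : y 0 = psi F G p (0, p) := by
    have h0 : ∀ i, gfun F G 0 (p i) = 0 := fun i => by ext j; simp [gfun, hsing]
    ext1 i
    by_cases h : i ∈ S <;> simp [y, h, psi, h0]
  have hyev := hy.continuousAt.eventually_mem (x := 0) (by rw [hy0]; exact himg)
  have hyev2 := hyev.filter_mono (nhdsWithin_le_nhds (s := {0}ᶜ))
  obtain ⟨e, ⟨a, ⟨⟨⟨⟨⟨A1, A2⟩, A3⟩, A4⟩, A5⟩, A6⟩, hay⟩, he⟩ :=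
    (hyev2.and self_mem_nhdsWithin).exists
  have he : e ≠ 0 := he
  obtain ⟨t, q⟩ := a
  simp only at A1 A2 A3 A4 A5 A6
  have hSg : ∀ i ∈ S, gfun F G t (q i) = 0 := by
    intro i hi
    have := congrArg Prod.fst (congrFun hay i)
    simpa [psi, y, hi] using this
  have hSp : ∀ i ∈ S, ∑ j, p i j * q i j = ∑ j, p i j * p i j := by
    intro i hi
    have := congrArg Prod.snd (congrFun hay i)
    simpa [psi, y, hi] using this
  have hNg : ∀ i, i ∉ S → gfun F G t (q i) = e • p i := by
    intro i hi
    have := congrArg Prod.fst (congrFun hay i)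
    simpa [psi, y, hi] using this
  have hNp : ∀ i, i ∉ S → ∑ j, p i j * q i j = ∑ j, p i j * p i j - e := by
    intro i hi
    have := congrArg Prod.snd (congrFun hay i)
    simpa [psi, y, hi] using this
  set F' := F + ∑ k, C (t k) * G k with hF'
  have hF'h : F'.IsHomogeneous 7 := by
    refine hF.add (IsHomogeneous.sum _ _ _ fun k _ => ?_)
    simpa using (isHomogeneous_C (Fin 4) (t k)).mul (hG k)
  have hmapF' : MvPolynomial.map (algebraMap ℝ ℂ) F' =
      Fc + ∑ k, C ((t k : ℝ) : ℂ) * Gc k := by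
    simp [hF', hFc, hGc]
  have hqne : ∀ i, cvec (q i) ≠ 0 := by
    intro i h
    have := congrFun h 2
    simp [cvec, A5 i] at this
  have hgc : ∀ v j, eval v (pderiv j (MvPolynomial.map (algebraMap ℝ ℂ) F')) =
      gfun Fc Gc (fun k => ((t k : ℝ) : ℂ)) v j := by
    intro v j; rw [hmapF', gfun_eq]
  have hqsing : ∀ i ∈ S, ∀ j,
      eval (cvec (q i)) (pderiv j (MvPolynomial.map (algebraMap ℝ ℂ) F')) = 0 := by
    intro i hi j
    rw [hgc, gfun_ofReal, hSg i hi]; simp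
  have hkap : ∀ i j, gfun Fc Gc (fun k => ((t k : ℝ) : ℂ)) (cvec (q i)) j +
      (∑ l, cvec (p i) l * cvec (q i) l - ∑ l, cvec (p i) l * cvec (p i) l) * cvec (p i) j = 0 := by
    intro i j
    rw [gfun_ofReal]
    have hr : gfun F G t (q i) j + (∑ l, p i l * q i l - ∑ l, p i l * p i l) * p i j = 0 := by
      by_cases hi : i ∈ S
      · rw [hSg i hi, hSp i hi]; simp
      · rw [hNg i hi, hNp i hi]; simp
    simp only [cvec]
    exact_mod_cast hr
  -- every singular vector is proportional to some q i, i ∈ S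
  have hmain : ∀ v : Fin 4 → ℂ, v ≠ 0 →
      (∀ j, eval v (pderiv j (MvPolynomial.map (algebraMap ℝ ℂ) F')) = 0) →
      ∃ i ∈ S, ∃ c : ℂ, c ≠ 0 ∧ c • v = cvec (q i) := by
    intro v hv hvs
    have hFm : (MvPolynomial.map (algebraMap ℝ ℂ) F').IsHomogeneous 7 := hF'h.map _
    have hscale : ∀ (c : ℂ) j, gfun Fc Gc (fun k => ((t k : ℝ) : ℂ)) (c • v) j = 0 := by
      intro c j
      rw [← hgc, eval_smul_homog (hFm.pderiv), hvs, mul_zero]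
    have hn : ((‖v‖⁻¹ : ℝ) : ℂ) ≠ 0 := by
      simpa using hv
    obtain ⟨i, hi1, hi2⟩ := A2 (((‖v‖⁻¹ : ℝ) : ℂ) • v) (by
      simp [norm_smul, hv]) (hscale _)
    set d := (∑ j, cvec (p i) j * cvec (p i) j) /
      (∑ j, cvec (p i) j * (((‖v‖⁻¹ : ℝ) : ℂ) • v) j) with hd
    have hd0 : d ≠ 0 := div_ne_zero (hpp i) hi1
    rw [smul_smul] at hi2
    have hv2 := A1 i _ hi2 _ (A3 i) (by
      intro j
      rw [hscale]
      have : ∑ l, cvec (p i) l * ((d * ((‖v‖⁻¹ : ℝ) : ℂ)) • v) l =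
          ∑ l, cvec (p i) l * cvec (p i) l := by
        have h1 : ∑ l, cvec (p i) l * ((d * ((‖v‖⁻¹ : ℝ) : ℂ)) • v) l =
          d * ∑ l, cvec (p i) l * (((‖v‖⁻¹ : ℝ) : ℂ) • v) l := by
          rw [Finset.mul_sum]
          refine Finset.sum_congr rfl fun l _ => by simp only [Pi.smul_apply, smul_eq_mul]; ring
        rw [h1, hd, div_mul_cancel₀ _ hi1]
      rw [this]; simp) (hkap i)
    refine ⟨i, ?_, _, mul_ne_zero hd0 hn, hv2⟩
    by_contra hi
    have h3 := hscale (d * ((‖v‖⁻¹ : ℝ) : ℂ)) 2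
    rw [hv2, gfun_ofReal, hNg i hi] at h3
    simp [hp2, he] at h3
  have hset : {P : Projectivization ℂ (Fin 4 → ℂ) |
      IsSingularPoint (MvPolynomial.map (algebraMap ℝ ℂ) F') P} =
      (fun i => Projectivization.mk ℂ (cvec (q i)) (hqne i)) '' (S : Set ι) := by
    ext P
    constructor
    · rintro ⟨v, hv, rfl, hvs⟩
      obtain ⟨i, hi, c, hc, hcv⟩ := hmain v hv hvs
      refine ⟨i, hi, ?_⟩
      exact (Projectivization.mk_eq_mk_iff' ℂ _ _ _ _).2 ⟨c, hcv⟩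
    · rintro ⟨i, hi, rfl⟩
      exact ⟨_, hqne i, rfl, hqsing i hi⟩
  refine ⟨F', hF'h, ?_, ?_, ?_⟩
  · rw [hset, Set.ncard_image_of_injOn, Set.ncard_coe_finset]
    intro i hi i' hi' h
    by_contra hne
    obtain ⟨c, hc⟩ := (Projectivization.mk_eq_mk_iff' ℂ _ _ _ _).1 h
    obtain ⟨j, hj⟩ := A6 i i' hne
    apply hj
    have e1 := congrFun hc j
    have e2 := congrFun hc 2
    simp only [cvec, Pi.smul_apply, smul_eq_mul] at e1 e2
    have : ((q i j * q i' 2 : ℝ) : ℂ) = ((q i 2 * q i' j : ℝ) : ℂ) := by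
      push_cast
      rw [← e1, ← e2]; ring
    exact_mod_cast this
  · intro P hP
    have : P ∈ {P : Projectivization ℂ (Fin 4 → ℂ) |
      IsSingularPoint (MvPolynomial.map (algebraMap ℝ ℂ) F') P} := hP
    rw [hset] at this
    obtain ⟨i, hi, rfl⟩ := this
    refine ⟨_, hqne i, rfl, hqsing i hi, ?_⟩
    refine rank_three (hF'h.map _) (cvec (p i)) _ (hqne i) (hqsing i hi) ?_
    rw [hmapF']
    exact A4 i
  · intro P hP
    have : P ∈ {P : Projectivization ℂ (Fin 4 → ℂ) |
      IsSingularPoint (MvPolynomial.map (algebraMap ℝ ℂ) F') P} := hP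
    rw [hset] at this
    obtain ⟨i, hi, rfl⟩ := this
    exact ⟨_, hqne i, rfl, fun j => ⟨q i j, rfl⟩⟩

end

section
open MvPolynomial

section septic
variable {R : Type*} [CommRing R]

/-- the cubic form used in the doubled part -/
def Cc (s z w : R) : R := 7 * w * s - 8 * w ^ 3 - 4 * w ^ 2 * z + 4 * w * z ^ 2 + 8 * z ^ 3
def Cw (s z w : R) : R := 7 * s - 24 * w ^ 2 - 8 * w * z + 4 * z ^ 2
def Cz (z w : R) : R := -4 * w ^ 2 + 8 * w * z + 24 * z ^ 2
def As (s z w : R) : R := 7 * z * (3 * s ^ 2 - 16 * z ^ 2 * s + 16 * z ^ 4) -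
  14 * (w - z) * w * Cc s z w
def Az (s z w : R) : R := 7 * s ^ 3 - 168 * z ^ 2 * s ^ 2 + 560 * z ^ 4 * s - 448 * z ^ 6 +
  Cc s z w ^ 2 - 2 * (w - z) * Cc s z w * Cz z w
def Aw (s z w : R) : R := - Cc s z w ^ 2 - 2 * (w - z) * Cc s z w * Cw s z w
def Ass (s z w : R) : R := 7 * z * (6 * s - 16 * z ^ 2) - 98 * (w - z) * w ^ 2
def Asz (s z w : R) : R := 7 * (3 * s ^ 2 - 48 * z ^ 2 * s + 80 * z ^ 4) + 14 * w * Cc s z w -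
  14 * w * (w - z) * Cz z w
def Asw (s z w : R) : R := - 14 * w * Cc s z w - 14 * (w - z) * Cc s z w -
  14 * (w - z) * w * Cw s z w
def Azz (s z w : R) : R := - 336 * z * s ^ 2 + 2240 * z ^ 3 * s - 2688 * z ^ 5 +
  4 * Cc s z w * Cz z w - 2 * (w - z) * (Cz z w ^ 2 + Cc s z w * (8 * w + 48 * z))
def Azw (s z w : R) : R := 2 * Cc s z w * Cw s z w - 2 * Cc s z w * Cz z w -
  2 * (w - z) * (Cw s z w * Cz z w + Cc s z w * (8 * z - 8 * w))
def Aww (s z w : R) : R := - 4 * Cc s z w * Cw s z w -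
  2 * (w - z) * (Cw s z w ^ 2 + Cc s z w * (- 48 * w - 8 * z))

/-- the septic of Labs -/
noncomputable def F0 (R : Type*) [CommRing R] : MvPolynomial (Fin 4) R :=
  (X 0 ^ 7 - 21 * (X 0 ^ 5 * X 1 ^ 2) + 35 * (X 0 ^ 3 * X 1 ^ 4) - 7 * (X 0 * X 1 ^ 6)) +
  7 * (X 2 * ((X 0 ^ 2 + X 1 ^ 2) ^ 3 - 8 * (X 2 ^ 2 * (X 0 ^ 2 + X 1 ^ 2) ^ 2)
    + 16 * (X 2 ^ 4 * (X 0 ^ 2 + X 1 ^ 2)))) - 64 * X 2 ^ 7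
  - (X 3 - X 2) * (7 * (X 3 * (X 0 ^ 2 + X 1 ^ 2)) - 8 * X 3 ^ 3 - 4 * (X 3 ^ 2 * X 2) +
    4 * (X 3 * X 2 ^ 2) + 8 * X 2 ^ 3) ^ 2

theorem C_num (k : ℕ) [k.AtLeastTwo] :
    (C (OfNat.ofNat k : R) : MvPolynomial (Fin 4) R) = OfNat.ofNat k :=
  map_ofNat C k

theorem hom_num {n : ℕ} (k : ℕ) [k.AtLeastTwo] {P : MvPolynomial (Fin 4) R}
    (h : P.IsHomogeneous n) : ((OfNat.ofNat k : MvPolynomial (Fin 4) R) * P).IsHomogeneous n := by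
  have := (isHomogeneous_C (Fin 4) (OfNat.ofNat k : R)).mul h
  rw [C_num] at this
  simpa using this

theorem hom_cast {n m : ℕ} {P : MvPolynomial (Fin 4) R} (h : P.IsHomogeneous n) (e : n = m) :
    P.IsHomogeneous m := e ▸ h

theorem F0_hom : (F0 R).IsHomogeneous 7 := by
  have hX : ∀ (i : Fin 4) (n : ℕ), (X i ^ n : MvPolynomial (Fin 4) R).IsHomogeneous n := fun i n =>
    isHomogeneous_X_pow i n
  have hX1 : ∀ (i : Fin 4), (X i : MvPolynomial (Fin 4) R).IsHomogeneous 1 := fun i =>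
    isHomogeneous_X R i
  have hS : (X 0 ^ 2 + X 1 ^ 2 : MvPolynomial (Fin 4) R).IsHomogeneous 2 := (hX 0 2).add (hX 1 2)
  have hQ : (7 * (X 3 * (X 0 ^ 2 + X 1 ^ 2)) - 8 * X 3 ^ 3 - 4 * (X 3 ^ 2 * X 2) +
    4 * (X 3 * X 2 ^ 2) + 8 * X 2 ^ 3 : MvPolynomial (Fin 4) R).IsHomogeneous 3 := by
    refine IsHomogeneous.add (IsHomogeneous.add (IsHomogeneous.sub (IsHomogeneous.sub ?_ ?_) ?_) ?_) ?_
    · exact hom_num 7 (hom_cast ((hX1 3).mul hS) (by norm_num))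
    · exact hom_num 8 (hX 3 3)
    · exact hom_num 4 (hom_cast ((hX 3 2).mul (hX1 2)) (by norm_num))
    · exact hom_num 4 (hom_cast ((hX1 3).mul (hX 2 2)) (by norm_num))
    · exact hom_num 8 (hX 2 3)
  have hL : (X 3 - X 2 : MvPolynomial (Fin 4) R).IsHomogeneous 1 := (hX1 3).sub (hX1 2)
  unfold F0
  refine IsHomogeneous.sub (IsHomogeneous.sub (IsHomogeneous.add ?_ ?_) ?_) ?_
  · refine IsHomogeneous.sub (IsHomogeneous.add (IsHomogeneous.sub ?_ ?_) ?_) ?_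
    · exact hX 0 7
    · exact hom_num 21 (hom_cast ((hX 0 5).mul (hX 1 2)) (by norm_num))
    · exact hom_num 35 (hom_cast ((hX 0 3).mul (hX 1 4)) (by norm_num))
    · exact hom_num 7 (hom_cast ((hX1 0).mul (hX 1 6)) (by norm_num))
  · refine hom_num 7 (hom_cast ((hX1 2).mul (n := 6) ?_) (by norm_num))
    refine IsHomogeneous.add (IsHomogeneous.sub ?_ ?_) ?_
    · exact hom_cast (hS.pow 3) (by norm_num)
    · exact hom_num 8 (hom_cast ((hX 2 2).mul (hS.pow 2)) (by norm_num))
    · exact hom_num 16 (hom_cast ((hX 2 4).mul hS) (by norm_num))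
  · exact hom_num 64 (hX 2 7)
  · exact hom_cast (hL.mul (hQ.pow 2)) (by norm_num)

theorem F0_map {S : Type*} [CommRing S] (f : R →+* S) : MvPolynomial.map f (F0 R) = F0 S := by
  simp [F0]

theorem pd_num (i : Fin 4) (k : ℕ) [k.AtLeastTwo] :
    pderiv i (ofNat(k) : MvPolynomial (Fin 4) R) = 0 := by
  have : (OfNat.ofNat k : MvPolynomial (Fin 4) R) = C (OfNat.ofNat k : R) := (C_num k).symm
  rw [this, pderiv_C]

end septic

end

section
open MvPolynomial
set_option linter.unusedSimpArgs false
section septic2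
variable {R : Type*} [CommRing R]

theorem F0_x : pderiv 0 (F0 R) = 7 * X 0 ^ 6 - 105 * (X 0 ^ 4 * X 1 ^ 2) +
    105 * (X 0 ^ 2 * X 1 ^ 4) - 7 * X 1 ^ 6 + 2 * X 0 * As (X 0 ^ 2 + X 1 ^ 2) (X 2) (X 3) := by
  simp only [F0, map_add, map_sub, pderiv_mul, pderiv_pow, pderiv_X, pd_num, Pi.single_apply]
  simp [As, Cc]
  ring
theorem F0_y : pderiv 1 (F0 R) = - 42 * X 0 ^ 5 * X 1 + 140 * (X 0 ^ 3 * X 1 ^ 3) -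
    42 * (X 0 * X 1 ^ 5) + 2 * X 1 * As (X 0 ^ 2 + X 1 ^ 2) (X 2) (X 3) := by
  simp only [F0, map_add, map_sub, pderiv_mul, pderiv_pow, pderiv_X, pd_num, Pi.single_apply]
  simp [As, Cc]
  ring
theorem F0_z : pderiv 2 (F0 R) = Az (X 0 ^ 2 + X 1 ^ 2) (X 2) (X 3) := by
  simp only [F0, map_add, map_sub, pderiv_mul, pderiv_pow, pderiv_X, pd_num, Pi.single_apply]
  simp [Az, Cc, Cz]
  ring
theorem F0_w : pderiv 3 (F0 R) = Aw (X 0 ^ 2 + X 1 ^ 2) (X 2) (X 3) := by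
  simp only [F0, map_add, map_sub, pderiv_mul, pderiv_pow, pderiv_X, pd_num, Pi.single_apply]
  simp [Aw, Cc, Cw]
  ring

theorem F0_xx : pderiv 0 (pderiv 0 (F0 R)) = 42 * X 0 ^ 5 - 420 * (X 0 ^ 3 * X 1 ^ 2) + 210 * (X 0 * X 1 ^ 4) + 2 * As (X 0 ^ 2 + X 1 ^ 2) (X 2) (X 3) + 4 * X 0 ^ 2 * Ass (X 0 ^ 2 + X 1 ^ 2) (X 2) (X 3) := by
  simp only [F0_x, As, Az, Aw, Cc, Cw, Cz, map_add, map_sub, map_neg, pderiv_mul, pderiv_pow, pderiv_X, pd_num,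
    Pi.single_apply]
  simp [As, Az, Aw, Ass, Asz, Asw, Azz, Azw, Aww, Cc, Cw, Cz]
  ring
theorem F0_xy : pderiv 1 (pderiv 0 (F0 R)) = - 210 * (X 0 ^ 4 * X 1) + 420 * (X 0 ^ 2 * X 1 ^ 3) - 42 * X 1 ^ 5 + 4 * X 0 * X 1 * Ass (X 0 ^ 2 + X 1 ^ 2) (X 2) (X 3) := by
  simp only [F0_x, As, Az, Aw, Cc, Cw, Cz, map_add, map_sub, map_neg, pderiv_mul, pderiv_pow, pderiv_X, pd_num,
    Pi.single_apply]
  simp [As, Az, Aw, Ass, Asz, Asw, Azz, Azw, Aww, Cc, Cw, Cz]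
  ring
theorem F0_xz : pderiv 2 (pderiv 0 (F0 R)) = 2 * X 0 * Asz (X 0 ^ 2 + X 1 ^ 2) (X 2) (X 3) := by
  simp only [F0_x, As, Az, Aw, Cc, Cw, Cz, map_add, map_sub, map_neg, pderiv_mul, pderiv_pow, pderiv_X, pd_num,
    Pi.single_apply]
  simp [As, Az, Aw, Ass, Asz, Asw, Azz, Azw, Aww, Cc, Cw, Cz]
  ring
theorem F0_xw : pderiv 3 (pderiv 0 (F0 R)) = 2 * X 0 * Asw (X 0 ^ 2 + X 1 ^ 2) (X 2) (X 3) := by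
  simp only [F0_x, As, Az, Aw, Cc, Cw, Cz, map_add, map_sub, map_neg, pderiv_mul, pderiv_pow, pderiv_X, pd_num,
    Pi.single_apply]
  simp [As, Az, Aw, Ass, Asz, Asw, Azz, Azw, Aww, Cc, Cw, Cz]
  ring
theorem F0_yx : pderiv 0 (pderiv 1 (F0 R)) = - 210 * (X 0 ^ 4 * X 1) + 420 * (X 0 ^ 2 * X 1 ^ 3) - 42 * X 1 ^ 5 + 4 * X 0 * X 1 * Ass (X 0 ^ 2 + X 1 ^ 2) (X 2) (X 3) := by
  simp only [F0_y, As, Az, Aw, Cc, Cw, Cz, map_add, map_sub, map_neg, pderiv_mul, pderiv_pow, pderiv_X, pd_num,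
    Pi.single_apply]
  simp [As, Az, Aw, Ass, Asz, Asw, Azz, Azw, Aww, Cc, Cw, Cz]
  ring
theorem F0_yy : pderiv 1 (pderiv 1 (F0 R)) = - 42 * X 0 ^ 5 + 420 * (X 0 ^ 3 * X 1 ^ 2) - 210 * (X 0 * X 1 ^ 4) + 2 * As (X 0 ^ 2 + X 1 ^ 2) (X 2) (X 3) + 4 * X 1 ^ 2 * Ass (X 0 ^ 2 + X 1 ^ 2) (X 2) (X 3) := by
  simp only [F0_y, As, Az, Aw, Cc, Cw, Cz, map_add, map_sub, map_neg, pderiv_mul, pderiv_pow, pderiv_X, pd_num,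
    Pi.single_apply]
  simp [As, Az, Aw, Ass, Asz, Asw, Azz, Azw, Aww, Cc, Cw, Cz]
  ring
theorem F0_yz : pderiv 2 (pderiv 1 (F0 R)) = 2 * X 1 * Asz (X 0 ^ 2 + X 1 ^ 2) (X 2) (X 3) := by
  simp only [F0_y, As, Az, Aw, Cc, Cw, Cz, map_add, map_sub, map_neg, pderiv_mul, pderiv_pow, pderiv_X, pd_num,
    Pi.single_apply]
  simp [As, Az, Aw, Ass, Asz, Asw, Azz, Azw, Aww, Cc, Cw, Cz]
  ring
theorem F0_yw : pderiv 3 (pderiv 1 (F0 R)) = 2 * X 1 * Asw (X 0 ^ 2 + X 1 ^ 2) (X 2) (X 3) := by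
  simp only [F0_y, As, Az, Aw, Cc, Cw, Cz, map_add, map_sub, map_neg, pderiv_mul, pderiv_pow, pderiv_X, pd_num,
    Pi.single_apply]
  simp [As, Az, Aw, Ass, Asz, Asw, Azz, Azw, Aww, Cc, Cw, Cz]
  ring
theorem F0_zx : pderiv 0 (pderiv 2 (F0 R)) = 2 * X 0 * Asz (X 0 ^ 2 + X 1 ^ 2) (X 2) (X 3) := by
  simp only [F0_z, As, Az, Aw, Cc, Cw, Cz, map_add, map_sub, map_neg, pderiv_mul, pderiv_pow, pderiv_X, pd_num,
    Pi.single_apply]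
  simp [As, Az, Aw, Ass, Asz, Asw, Azz, Azw, Aww, Cc, Cw, Cz]
  ring
theorem F0_zy : pderiv 1 (pderiv 2 (F0 R)) = 2 * X 1 * Asz (X 0 ^ 2 + X 1 ^ 2) (X 2) (X 3) := by
  simp only [F0_z, As, Az, Aw, Cc, Cw, Cz, map_add, map_sub, map_neg, pderiv_mul, pderiv_pow, pderiv_X, pd_num,
    Pi.single_apply]
  simp [As, Az, Aw, Ass, Asz, Asw, Azz, Azw, Aww, Cc, Cw, Cz]
  ring
theorem F0_zz : pderiv 2 (pderiv 2 (F0 R)) = Azz (X 0 ^ 2 + X 1 ^ 2) (X 2) (X 3) := by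
  simp only [F0_z, As, Az, Aw, Cc, Cw, Cz, map_add, map_sub, map_neg, pderiv_mul, pderiv_pow, pderiv_X, pd_num,
    Pi.single_apply]
  simp [As, Az, Aw, Ass, Asz, Asw, Azz, Azw, Aww, Cc, Cw, Cz]
  ring
theorem F0_zw : pderiv 3 (pderiv 2 (F0 R)) = Azw (X 0 ^ 2 + X 1 ^ 2) (X 2) (X 3) := by
  simp only [F0_z, As, Az, Aw, Cc, Cw, Cz, map_add, map_sub, map_neg, pderiv_mul, pderiv_pow, pderiv_X, pd_num,
    Pi.single_apply]
  simp [As, Az, Aw, Ass, Asz, Asw, Azz, Azw, Aww, Cc, Cw, Cz]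
  ring
theorem F0_wx : pderiv 0 (pderiv 3 (F0 R)) = 2 * X 0 * Asw (X 0 ^ 2 + X 1 ^ 2) (X 2) (X 3) := by
  simp only [F0_w, As, Az, Aw, Cc, Cw, Cz, map_add, map_sub, map_neg, pderiv_mul, pderiv_pow, pderiv_X, pd_num,
    Pi.single_apply]
  simp [As, Az, Aw, Ass, Asz, Asw, Azz, Azw, Aww, Cc, Cw, Cz]
  ring
theorem F0_wy : pderiv 1 (pderiv 3 (F0 R)) = 2 * X 1 * Asw (X 0 ^ 2 + X 1 ^ 2) (X 2) (X 3) := by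
  simp only [F0_w, As, Az, Aw, Cc, Cw, Cz, map_add, map_sub, map_neg, pderiv_mul, pderiv_pow, pderiv_X, pd_num,
    Pi.single_apply]
  simp [As, Az, Aw, Ass, Asz, Asw, Azz, Azw, Aww, Cc, Cw, Cz]
  ring
theorem F0_wz : pderiv 2 (pderiv 3 (F0 R)) = Azw (X 0 ^ 2 + X 1 ^ 2) (X 2) (X 3) := by
  simp only [F0_w, As, Az, Aw, Cc, Cw, Cz, map_add, map_sub, map_neg, pderiv_mul, pderiv_pow, pderiv_X, pd_num,
    Pi.single_apply]
  simp [As, Az, Aw, Ass, Asz, Asw, Azz, Azw, Aww, Cc, Cw, Cz]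
  ring
theorem F0_ww : pderiv 3 (pderiv 3 (F0 R)) = Aww (X 0 ^ 2 + X 1 ^ 2) (X 2) (X 3) := by
  simp only [F0_w, As, Az, Aw, Cc, Cw, Cz, map_add, map_sub, map_neg, pderiv_mul, pderiv_pow, pderiv_X, pd_num,
    Pi.single_apply]
  simp [As, Az, Aw, Ass, Asz, Asw, Azz, Azw, Aww, Cc, Cw, Cz]
  ring

end septic2

end

section
open MvPolynomial
set_option linter.unusedSimpArgs false
section
variable {R S : Type*} [CommRing R] [CommRing S] (f : R →+* S) (s z w : R)
theorem map_Cc : f (Cc s z w) = Cc (f s) (f z) (f w) := by simp [map_ofNat, Cc]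
theorem map_Cw : f (Cw s z w) = Cw (f s) (f z) (f w) := by simp [map_ofNat, Cw]
theorem map_Cz : f (Cz z w) = Cz (f z) (f w) := by simp [map_ofNat, Cz]
theorem map_As : f (As s z w) = As (f s) (f z) (f w) := by simp [map_ofNat, As, map_Cc]
theorem map_Az : f (Az s z w) = Az (f s) (f z) (f w) := by simp [map_ofNat, Az, map_Cc, map_Cz]
theorem map_Aw : f (Aw s z w) = Aw (f s) (f z) (f w) := by simp [map_ofNat, Aw, map_Cc, map_Cw]
theorem map_Ass : f (Ass s z w) = Ass (f s) (f z) (f w) := by simp [map_ofNat, Ass]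
theorem map_Asz : f (Asz s z w) = Asz (f s) (f z) (f w) := by simp [map_ofNat, Asz, map_Cc, map_Cz]
theorem map_Asw : f (Asw s z w) = Asw (f s) (f z) (f w) := by simp [map_ofNat, Asw, map_Cc, map_Cw]
theorem map_Azz : f (Azz s z w) = Azz (f s) (f z) (f w) := by simp [map_ofNat, Azz, map_Cc, map_Cz]
theorem map_Azw : f (Azw s z w) = Azw (f s) (f z) (f w) := by simp [map_ofNat, Azw, map_Cc, map_Cw, map_Cz]
theorem map_Aww : f (Aww s z w) = Aww (f s) (f z) (f w) := by simp [map_ofNat, Aww, map_Cc, map_Cw]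
end

structure GoodPt (x w : ℝ) : Prop where
  hx : 7 * x ^ 6 + 2 * x * As (x ^ 2) 1 w = 0
  hz : Az (x ^ 2) 1 w = 0
  hw : Aw (x ^ 2) 1 w = 0
  hb : 21 * x ^ 5 - As (x ^ 2) 1 w ≠ 0
  hd : (42 * x ^ 5 + 2 * As (x ^ 2) 1 w + 4 * x ^ 2 * Ass (x ^ 2) 1 w) * Aww (x ^ 2) 1 w -
    (2 * x * Asw (x ^ 2) 1 w) ^ 2 ≠ 0

structure Rot (c s : ℝ) : Prop where
  hcs : c ^ 2 + s ^ 2 = 1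
  h5r : c ^ 5 - 10 * c ^ 3 * s ^ 2 + 5 * c * s ^ 4 = c ^ 2 - s ^ 2
  h5i : 5 * c ^ 4 * s - 10 * c ^ 2 * s ^ 3 + s ^ 5 = - 2 * c * s

theorem good_sing {x w c s : ℝ} (hg : GoodPt x w) (hr : Rot c s) (j : Fin 4) :
    eval ![x * c, x * s, 1, w] (pderiv j (F0 ℝ)) = 0 := by
  have e1 : (x * c) ^ 2 + (x * s) ^ 2 = x ^ 2 := by linear_combination x ^ 2 * hr.hcs
  obtain ⟨hcs, h5r, h5i⟩ := hr
  fin_cases j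
  · simp [F0_x, map_As, e1]
    linear_combination c * hg.hx + 7 * x ^ 6 * (c * h5r - s * h5i + c * hcs)
  · simp [F0_y, map_As, e1]
    linear_combination s * hg.hx + 7 * x ^ 6 * (- s * h5r - c * h5i + s * hcs)
  · simp [F0_z, map_Az, e1]
    exact hg.hz
  · simp [F0_w, map_Aw, e1]
    exact hg.hw

theorem euler_A1 (s w : ℝ) : 2 * s * Ass s 1 w + Asz s 1 w + w * Asw s 1 w = 5 * As s 1 w := by
  simp only [Ass, Asz, Asw, As, Cc, Cz, Cw]; ring
theorem euler_A2 (s w : ℝ) : 2 * s * Asw s 1 w + Azw s 1 w + w * Aww s 1 w = 6 * Aw s 1 w := by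
  simp only [Aww, Azw, Asw, Aw, Cc, Cz, Cw]; ring

theorem good_node {x w c s : ℝ} (hg : GoodPt x w) (hr : Rot c s) (u : Fin 4 → ℂ)
    (hu : ∀ j, ∑ l, ((eval ![x * c, x * s, 1, w] (pderiv l (pderiv j (F0 ℝ))) : ℝ) : ℂ) * u l = 0) :
    ∃ k : ℂ, u = k • cvec ![x * c, x * s, 1, w] := by
  have e1 : (x * c) ^ 2 + (x * s) ^ 2 = x ^ 2 := by linear_combination x ^ 2 * hr.hcs
  have E1 := euler_A1 (x ^ 2) w
  have E2 := euler_A2 (x ^ 2) w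
  rw [hg.hw, mul_zero] at E2
  obtain ⟨hcs, h5r, h5i⟩ := hr
  obtain ⟨hx, -, -, hb, hd⟩ := hg
  have u0 := hu 0
  have u1 := hu 1
  have u3 := hu 3
  simp only [Fin.sum_univ_four, F0_xx, F0_xy, F0_xz, F0_xw, F0_yx, F0_yy, F0_yz, F0_yw, F0_wx,
    F0_wy, F0_wz, F0_ww, map_add, map_sub, map_mul, map_pow, map_neg, map_ofNat, eval_X,
    map_As, map_Ass, map_Asz, map_Asw, map_Azw, map_Aww] at u0 u1 u3
  simp only [Matrix.cons_val_zero, Matrix.cons_val_one, Matrix.cons_val] at u0 u1 u3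
  simp only [e1] at u0 u1 u3
  generalize As (x ^ 2) 1 w = a at *
  generalize Ass (x ^ 2) 1 w = ass at *
  generalize Asz (x ^ 2) 1 w = asz at *
  generalize Asw (x ^ 2) 1 w = asw at *
  generalize Azw (x ^ 2) 1 w = azw at *
  generalize Aww (x ^ 2) 1 w = aww at *
  have c1 : (c : ℂ) ^ 2 + (s : ℂ) ^ 2 = 1 := by exact_mod_cast hcs
  have c2 : (c : ℂ) ^ 5 - 10 * c ^ 3 * s ^ 2 + 5 * c * s ^ 4 = c ^ 2 - s ^ 2 := by exact_mod_cast h5r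
  have c3 : 5 * (c : ℂ) ^ 4 * s - 10 * c ^ 2 * s ^ 3 + s ^ 5 = - 2 * c * s := by exact_mod_cast h5i
  have cx : 7 * (x : ℂ) ^ 6 + 2 * x * a = 0 := by exact_mod_cast hx
  have cE1 : 2 * (x : ℂ) ^ 2 * ass + asz + w * asw = 5 * a := by exact_mod_cast E1
  have cE2 : 2 * (x : ℂ) ^ 2 * asw + azw + w * aww = 0 := by exact_mod_cast E2
  have cb : 21 * (x : ℂ) ^ 5 - a ≠ 0 := by exact_mod_cast hb
  have cd : (42 * (x : ℂ) ^ 5 + 2 * a + 4 * x ^ 2 * ass) * aww - (2 * x * asw) ^ 2 ≠ 0 := by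
    exact_mod_cast hd
  push_cast at u0 u1 u3
  clear hu E1 E2 hb hd hx hcs h5r h5i e1
  have R1 : (42 * (x : ℂ) ^ 5 + 2 * (a : ℂ) + 4 * (x : ℂ) ^ 2 * (ass : ℂ)) * ((c : ℂ) * u 0 + (s : ℂ) * u 1) +
      2 * (x : ℂ) * (asz : ℂ) * u 2 + 2 * (x : ℂ) * (asw : ℂ) * u 3 = 0 := by
    linear_combination (c : ℂ) * u0 + (s : ℂ) * u1 - 42 * (x : ℂ) ^ 5 * ((c : ℂ) * u 0 - (s : ℂ) * u 1) * c2 +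
      42 * (x : ℂ) ^ 5 * ((c : ℂ) * u 1 + (s : ℂ) * u 0) * c3 -
      ((42 * (x : ℂ) ^ 5 + 4 * (x : ℂ) ^ 2 * (ass : ℂ)) * ((c : ℂ) * u 0 + (s : ℂ) * u 1) + 2 * (x : ℂ) * (asz : ℂ) * u 2 +
        2 * (x : ℂ) * (asw : ℂ) * u 3) * c1
  have R2 : (21 * (x : ℂ) ^ 5 - (a : ℂ)) * (- (s : ℂ) * u 0 + (c : ℂ) * u 1) = 0 := by
    linear_combination (-1 / 2) * (- (s : ℂ) * u0 + (c : ℂ) * u1 - 42 * (x : ℂ) ^ 5 * (- (s : ℂ) * u 0 - (c : ℂ) * u 1) * c2 +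
      42 * (x : ℂ) ^ 5 * (- (s : ℂ) * u 1 + (c : ℂ) * u 0) * c3) + 21 * (x : ℂ) ^ 5 * ((s : ℂ) * u 0 - (c : ℂ) * u 1) * c1
  have R3 : 2 * (x : ℂ) * (asw : ℂ) * ((c : ℂ) * u 0 + (s : ℂ) * u 1) + (azw : ℂ) * u 2 + (aww : ℂ) * u 3 = 0 := by
    linear_combination u3
  have R4 := (mul_eq_zero.1 R2).resolve_left cb
  have S1 : (42 * (x : ℂ) ^ 5 + 2 * (a : ℂ) + 4 * (x : ℂ) ^ 2 * (ass : ℂ)) * ((c : ℂ) * u 0 + (s : ℂ) * u 1 - (x : ℂ) * u 2) +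
      2 * (x : ℂ) * (asw : ℂ) * (u 3 - (w : ℂ) * u 2) = 0 := by
    linear_combination R1 - 6 * u 2 * cx - 2 * (x : ℂ) * u 2 * cE1
  have S3 : 2 * (x : ℂ) * (asw : ℂ) * ((c : ℂ) * u 0 + (s : ℂ) * u 1 - (x : ℂ) * u 2) + (aww : ℂ) * (u 3 - (w : ℂ) * u 2) = 0 := by
    linear_combination R3 - u 2 * cE2
  have T1 : ((42 * (x : ℂ) ^ 5 + 2 * (a : ℂ) + 4 * (x : ℂ) ^ 2 * (ass : ℂ)) * (aww : ℂ) - (2 * (x : ℂ) * (asw : ℂ)) ^ 2) *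
      ((c : ℂ) * u 0 + (s : ℂ) * u 1 - (x : ℂ) * u 2) = 0 := by
    linear_combination (aww : ℂ) * S1 - 2 * (x : ℂ) * (asw : ℂ) * S3
  have T2 : ((42 * (x : ℂ) ^ 5 + 2 * (a : ℂ) + 4 * (x : ℂ) ^ 2 * (ass : ℂ)) * (aww : ℂ) - (2 * (x : ℂ) * (asw : ℂ)) ^ 2) *
      (u 3 - (w : ℂ) * u 2) = 0 := by
    linear_combination (42 * (x : ℂ) ^ 5 + 2 * (a : ℂ) + 4 * (x : ℂ) ^ 2 * (ass : ℂ)) * S3 - 2 * (x : ℂ) * (asw : ℂ) * S1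
  have T3 := (mul_eq_zero.1 T1).resolve_left cd
  have T4 := (mul_eq_zero.1 T2).resolve_left cd
  refine ⟨u 2, ?_⟩
  ext j
  fin_cases j
  · simp [cvec]
    linear_combination (c : ℂ) * T3 - (s : ℂ) * R4 - u 0 * c1
  · simp [cvec]
    linear_combination (s : ℂ) * T3 + (c : ℂ) * R4 - u 1 * c1
  · simp [cvec]
  · simp [cvec]
    linear_combination T4

end

section
set_option linter.unusedSimpArgs false

theorem good_T1 (d : ℝ) (h : d ^ 3 + d ^ 2 - 2 * d - 1 = 0) : GoodPt (2 * d ^ 2 + 2 * d - 4) (2 * d ^ 2 + 2 * d - 4) where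
  hx := by
    simp only [As, Az, Aw, Cc, Cz, Cw]
    linear_combination ((18816) + (-9408) * d ^ 1 + (-80192) * d ^ 2 + (48832) * d ^ 3 + (89600) * d ^ 4 + (-36288) * d ^ 5 + (-48832) * d ^ 6 + (4032) * d ^ 7 + (11200) * d ^ 8 + (2240) * d ^ 9) * h
  hz := by
    simp only [As, Az, Aw, Cc, Cz, Cw]
    linear_combination 0 * h
  hw := by
    simp only [As, Az, Aw, Cc, Cz, Cw]
    linear_combination ((-18816) + (9408) * d ^ 1 + (80192) * d ^ 2 + (-48832) * d ^ 3 + (-89600) * d ^ 4 + (36288) * d ^ 5 + (48832) * d ^ 6 + (-4032) * d ^ 7 + (-11200) * d ^ 8 + (-2240) * d ^ 9) * h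
  hb := by
    simp only [As, Ass, Asw, Aww, Cc, Cz, Cw]
    intro h2
    apply one_ne_zero (α := ℝ)
    linear_combination ((3 / 784) + (5 / 784) * d ^ 1 + (-1 / 196) * d ^ 2) * h2 + ((-106) + (259) * d ^ 1 + (-498 / 7) * d ^ 2 + (-219) * d ^ 3 + (100) * d ^ 4 + (536 / 7) * d ^ 5 + (-219 / 7) * d ^ 6 + (-14) * d ^ 7 + (22 / 7) * d ^ 8 + (8 / 7) * d ^ 9) * h
  hd := by
    simp only [As, Ass, Asw, Aww, Cc, Cz, Cw]
    intro h2
    apply one_ne_zero (α := ℝ)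
    linear_combination ((5095 / 4132946944) + (3287 / 2066473472) * d ^ 1 + (-10957 / 4132946944) * d ^ 2) * h2 + ((-414376 / 1681) + (61868726 / 11767) * d ^ 1 + (-2785949067 / 82369) * d ^ 2 + (4210102816 / 82369) * d ^ 3 + (977895491 / 11767) * d ^ 4 + (-18657521517 / 82369) * d ^ 5 + (-4757283099 / 82369) * d ^ 6 + (31830683938 / 82369) * d ^ 7 + (-874570421 / 82369) * d ^ 8 + (-30979568409 / 82369) * d ^ 9 + (2051078426 / 82369) * d ^ 10 + (19281195302 / 82369) * d ^ 11 + (115006575 / 82369) * d ^ 12 + (-7695974010 / 82369) * d ^ 13 + (-1025754525 / 82369) * d ^ 14 + (1761711015 / 82369) * d ^ 15 + (510663600 / 82369) * d ^ 16 + (-149252400 / 82369) * d ^ 17 + (-82835100 / 82369) * d ^ 18 + (-9861300 / 82369) * d ^ 19) * h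

theorem good_T2 (d : ℝ) (h : d ^ 3 + d ^ 2 - 2 * d - 1 = 0) : GoodPt (2 * d ^ 2 + 2 * d - 4) (- 1 / 2 - d) where
  hx := by
    simp only [As, Az, Aw, Cc, Cz, Cw]
    linear_combination ((5096) + (3332) * d ^ 1 + (-17920) * d ^ 2 + (-3220) * d ^ 3 + (15288) * d ^ 4 + (-560) * d ^ 5 + (-6048) * d ^ 6 + (1344) * d ^ 7 + (2240) * d ^ 8 + (448) * d ^ 9) * h
  hz := by
    simp only [As, Az, Aw, Cc, Cz, Cw]
    linear_combination ((6174) + (-5782) * d ^ 1 + (-16632) * d ^ 2 + (12068) * d ^ 3 + (17948) * d ^ 4 + (-7644) * d ^ 5 + (-9856) * d ^ 6 + (784) * d ^ 7 + (2240) * d ^ 8 + (448) * d ^ 9) * h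
  hw := by
    simp only [As, Az, Aw, Cc, Cz, Cw]
    linear_combination ((19600) + (-21364) * d ^ 1 + (-43960) * d ^ 2 + (28308) * d ^ 3 + (38780) * d ^ 4 + (-3836) * d ^ 5 + (-10976) * d ^ 6 + (-2352) * d ^ 7) * h
  hb := by
    simp only [As, Ass, Asw, Aww, Cc, Cz, Cw]
    intro h2
    apply one_ne_zero (α := ℝ)
    linear_combination ((3 / 784) + (5 / 784) * d ^ 1 + (-1 / 196) * d ^ 2) * h2 + ((-1591 / 16) + (2137 / 8) * d ^ 1 + (-12599 / 112) * d ^ 2 + (-14125 / 56) * d ^ 3 + (5025 / 28) * d ^ 4 + (1521 / 14) * d ^ 5 + (-503 / 7) * d ^ 6 + (-198 / 7) * d ^ 7 + (66 / 7) * d ^ 8 + (24 / 7) * d ^ 9) * h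
  hd := by
    simp only [As, Ass, Asw, Aww, Cc, Cz, Cw]
    intro h2
    apply one_ne_zero (α := ℝ)
    linear_combination ((-31845 / 87308504192) + (-38029 / 87308504192) * d ^ 1 + (36615 / 43654252096) * d ^ 2) * h2 + ((354061121 / 4545424) + (-48252811 / 1223768) * d ^ 1 + (74448410163 / 222725776) * d ^ 2 + (-72399802877 / 111362888) * d ^ 3 + (-163595971323 / 55681444) * d ^ 4 + (91442371689 / 27840722) * d ^ 5 + (60307847363 / 7954492) * d ^ 6 + (-163449556637 / 27840722) * d ^ 7 + (-577031882507 / 55681444) * d ^ 8 + (132889800851 / 27840722) * d ^ 9 + (474197985493 / 55681444) * d ^ 10 + (-39873938841 / 27840722) * d ^ 11 + (-57635666222 / 13920361) * d ^ 12 + (-4659212244 / 13920361) * d ^ 13 + (14304848160 / 13920361) * d ^ 14 + (317226288 / 1070797) * d ^ 15 + (-1051123704 / 13920361) * d ^ 16 + (-87672384 / 1988623) * d ^ 17 + (-10545120 / 1988623) * d ^ 18) * h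

theorem good_T3 (d : ℝ) (h : d ^ 3 + d ^ 2 - 2 * d - 1 = 0) : GoodPt (2 * d ^ 2 + 2 * d - 4) (d - (2 * d ^ 2 + 2 * d - 4)) where
  hx := by
    simp only [As, Az, Aw, Cc, Cz, Cw]
    linear_combination ((140672) + (-234304) * d ^ 1 + (-168896) * d ^ 2 + (362208) * d ^ 3 + (93408) * d ^ 4 + (-206752) * d ^ 5 + (-40992) * d ^ 6 + (45696) * d ^ 7 + (10304) * d ^ 8 + (-1344) * d ^ 9) * h
  hz := by
    simp only [As, Az, Aw, Cc, Cz, Cw]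
    linear_combination ((-31360) * d ^ 1 + (-784) * d ^ 2 + (70560) * d ^ 3 + (9856) * d ^ 4 + (-50512) * d ^ 5 + (-12880) * d ^ 6 + (11536) * d ^ 7 + (4032) * d ^ 8) * h
  hw := by
    simp only [As, Az, Aw, Cc, Cz, Cw]
    linear_combination ((198016) + (-216160) * d ^ 1 + (-357616) * d ^ 2 + (357056) * d ^ 3 + (257600) * d ^ 4 + (-201936) * d ^ 5 + (-90160) * d ^ 6 + (42896) * d ^ 7 + (12544) * d ^ 8 + (-2240) * d ^ 9) * h
  hb := by
    simp only [As, Ass, Asw, Aww, Cc, Cz, Cw]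
    intro h2
    apply one_ne_zero (α := ℝ)
    linear_combination ((3 / 784) + (5 / 784) * d ^ 1 + (-1 / 196) * d ^ 2) * h2 + ((-1150 / 7) + (1682 / 7) * d ^ 1 + (2657 / 14) * d ^ 2 + (-641 / 2) * d ^ 3 + (-257 / 2) * d ^ 4 + (2659 / 14) * d ^ 5 + (320 / 7) * d ^ 6 + (-376 / 7) * d ^ 7 + (-6) * d ^ 8 + (40 / 7) * d ^ 9) * h
  hd := by
    simp only [As, Ass, Asw, Aww, Cc, Cz, Cw]
    intro h2
    apply one_ne_zero (α := ℝ)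
    linear_combination ((1193 / 415507456) + (1929 / 415507456) * d ^ 1 + (-211 / 51938432) * d ^ 2) * h2 + ((-594982434 / 8281) + (-868902597 / 8281) * d ^ 1 + (11212438763 / 16562) * d ^ 2 + (3574424239 / 8281) * d ^ 3 + (-20261161846 / 8281) * d ^ 4 + (-2949857346 / 8281) * d ^ 5 + (34104545164 / 8281) * d ^ 6 + (-1315630052 / 8281) * d ^ 7 + (-4632156587 / 1183) * d ^ 8 + (3049354405 / 8281) * d ^ 9 + (388466804 / 169) * d ^ 10 + (-1598822776 / 8281) * d ^ 11 + (-7049051774 / 8281) * d ^ 12 + (273745929 / 8281) * d ^ 13 + (3164993735 / 16562) * d ^ 14 + (31142271 / 8281) * d ^ 15 + (-188844090 / 8281) * d ^ 16 + (-13294026 / 8281) * d ^ 17 + (8205180 / 8281) * d ^ 18 + (627936 / 8281) * d ^ 19) * h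

theorem good_T4 (d : ℝ) (h : d ^ 3 + d ^ 2 - 2 * d - 1 = 0) : GoodPt (2 * d ^ 2 + 2 * d - 4 + 2) (1 + d) where
  hx := by
    simp only [As, Az, Aw, Cc, Cz, Cw]
    linear_combination ((-448) + (224) * d ^ 1 + (4480) * d ^ 2 + (224) * d ^ 3 + (-8288) * d ^ 4 + (-5824) * d ^ 5 + (1568) * d ^ 6 + (4032) * d ^ 7 + (2240) * d ^ 8 + (448) * d ^ 9) * h
  hz := by
    simp only [As, Az, Aw, Cc, Cz, Cw]
    linear_combination ((-336) + (1792) * d ^ 1 + (-336) * d ^ 2 + (-5488) * d ^ 3 + (-3248) * d ^ 4 + (-224) * d ^ 5 + (1680) * d ^ 6 + (3472) * d ^ 7 + (2240) * d ^ 8 + (448) * d ^ 9) * h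
  hw := by
    simp only [As, Az, Aw, Cc, Cz, Cw]
    linear_combination ((784) + (-4704) * d ^ 1 + (784) * d ^ 2 + (17808) * d ^ 3 + (9520) * d ^ 4 + (-10304) * d ^ 5 + (-10192) * d ^ 6 + (-2352) * d ^ 7) * h
  hb := by
    simp only [As, Ass, Asw, Aww, Cc, Cz, Cw]
    intro h2
    apply one_ne_zero (α := ℝ)
    linear_combination ((-1 / 98) + (-11 / 784) * d ^ 1 + (1 / 56) * d ^ 2) * h2 + ((41 / 7) + (-316 / 7) * d ^ 1 + (1049 / 14) * d ^ 2 + (911 / 14) * d ^ 3 + (-2049 / 14) * d ^ 4 + (-451 / 14) * d ^ 5 + (110) * d ^ 6 + (102 / 7) * d ^ 7 + (-270 / 7) * d ^ 8 + (-12) * d ^ 9) * h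
  hd := by
    simp only [As, Ass, Asw, Aww, Cc, Cz, Cw]
    intro h2
    apply one_ne_zero (α := ℝ)
    linear_combination ((-521 / 59358208) + (-103 / 8479744) * d ^ 1 + (913 / 59358208) * d ^ 2) * h2 + ((3478 / 169) + (1217 / 169) * d ^ 1 + (-149901 / 1183) * d ^ 2 + (-1256791 / 1183) * d ^ 3 + (-71892 / 1183) * d ^ 4 + (6720241 / 1183) * d ^ 5 + (14773631 / 2366) * d ^ 6 + (-6032357 / 1183) * d ^ 7 + (-35297287 / 2366) * d ^ 8 + (-21096787 / 2366) * d ^ 9 + (22271523 / 2366) * d ^ 10 + (42376695 / 2366) * d ^ 11 + (11342943 / 2366) * d ^ 12 + (-21721891 / 2366) * d ^ 13 + (-8553099 / 1183) * d ^ 14 + (30837 / 2366) * d ^ 15 + (2244831 / 1183) * d ^ 16 + (129450 / 169) * d ^ 17 + (16434 / 169) * d ^ 18) * h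

theorem good_T5 (d : ℝ) (h : 5 * d ^ 2 - 2 * d - 4 = 0) : GoodPt (d) (d) where
  hx := by
    simp only [As, Az, Aw, Cc, Cz, Cw]
    linear_combination ((-56) * d ^ 1 + (-28) * d ^ 2 + (28) * d ^ 3 + (7) * d ^ 4) * h
  hz := by
    simp only [As, Az, Aw, Cc, Cz, Cw]
    linear_combination 0 * h
  hw := by
    simp only [As, Az, Aw, Cc, Cz, Cw]
    linear_combination ((56) * d ^ 1 + (28) * d ^ 2 + (-28) * d ^ 3 + (-7) * d ^ 4) * h
  hb := by
    simp only [As, Ass, Asw, Aww, Cc, Cz, Cw]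
    intro h2
    apply one_ne_zero (α := ℝ)
    linear_combination ((-6 / 49) + (205 / 1568) * d ^ 1) * h2 + ((89 / 28) + (-51 / 28) * d ^ 1 + (-439 / 112) * d ^ 2 + (391 / 224) * d ^ 3 + (-41 / 224) * d ^ 4) * h
  hd := by
    simp only [As, Ass, Asw, Aww, Cc, Cz, Cw]
    intro h2
    apply one_ne_zero (α := ℝ)
    linear_combination ((-15527 / 590420992) + (66755 / 3542525952) * d ^ 1) * h2 + ((940 / 11767) + (294613 / 282408) * d ^ 1 + (-1703873 / 564816) * d ^ 2 + (-2588405 / 564816) * d ^ 3 + (2557469 / 322752) * d ^ 4 + (18891709 / 4518528) * d ^ 5 + (-8483665 / 1506176) * d ^ 6 + (-5111815 / 6024704) * d ^ 7 + (2505525 / 3012352) * d ^ 8 + (1001325 / 6024704) * d ^ 9) * h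

theorem good_axis : GoodPt 0 0 := by
  constructor <;> norm_num [As, Az, Aw, Ass, Asw, Aww, Cc, Cz, Cw]

end

section
open MvPolynomial

/-- the possible planar critical points over the complex numbers -/
def Planar (x w : ℂ) : Prop :=
  (x = 0 ∧ w = 0) ∨ (5 * x ^ 2 - 2 * x - 4 = 0 ∧ w = x) ∨
  ∃ d : ℂ, d ^ 3 + d ^ 2 - 2 * d - 1 = 0 ∧
    ((x = 2 * d ^ 2 + 2 * d - 4 ∧ (w = 2 * d ^ 2 + 2 * d - 4 ∨ w = - 1 / 2 - d ∨
      w = d - (2 * d ^ 2 + 2 * d - 4))) ∨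
     (x = 2 * d ^ 2 + 2 * d - 4 + 2 ∧ w = 1 + d))

theorem planar_h (x w : ℂ) (g1 : x ^ 2 * (3 * w - 2) - 4 * w * (2 * w + 1) * (w - 1) = 0)
    (g2 : (x ^ 2 + 2 * x - 4) ^ 2 - 16 * (w - 1) * w ^ 2 * (x - 1) = 0)
    (g3 : (x ^ 3 + 4 * x ^ 2 - 4 * x - 8) * (x ^ 2 + 2 * x - 4) -
      4 * (w - 1) * w * (7 * w * x ^ 2 - 8 * w ^ 3 - 4 * w ^ 2 + 4 * w + 8) = 0) :
    (w - x) * (w * x - 2 * w - x) = 0 := by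
  linear_combination ((-274/27)*1 + (-1823/216)*x^1*w^2 + (-445/36)*x^1*w^1 + (413/216)*x^2 + (-1639/108)*w^3 + (485/54)*x^1 + (107/18)*w^1 + (7/108)*w^2 + (371/18)*w^4 + (-19/36)*x^2*w^1 + (-395/216)*x^3 + (-23/3)*w^5 + (5/4)*x^2*w^2 + (343/144)*x^3*w^1 + (5267/216)*x^1*w^3 + (-341/864)*x^4 + (29/72)*x^4*w^1 + (-203/18)*x^1*w^4)*g1 + ((-53/432)*x^2 + (1/3)*x^1 + (1025/216)*w^1 + (-1/12)*x^1*w^1 + (-1)*1 + (-55/16)*x^1*w^2 + (-745/216)*w^2 + (23/12)*x^1*w^3 + (-253/54)*w^3 + (29/9)*w^4)*g2 + ((-2/3)*x^1 + (-77/48)*w^1 + (1/2)*1 + (85/24)*w^2 + (-23/12)*w^3 + (191/96)*x^1*w^1 + (-29/24)*x^1*w^2)*g3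

theorem root_d (x : ℂ) (hQ : x ^ 3 + 4 * x ^ 2 - 4 * x - 8 = 0) :
    ∃ d : ℂ, d ^ 3 + d ^ 2 - 2 * d - 1 = 0 ∧ x = 2 * d ^ 2 + 2 * d - 4 ∧ d * x = 2 ∧
      4 * d = x ^ 2 + 4 * x - 4 := by
  have h1 : ((x ^ 2 + 4 * x - 4) / 4) * x = 2 := by linear_combination hQ / 4
  have hx : x ≠ 0 := by
    rintro rfl
    norm_num at hQ
  refine ⟨(x ^ 2 + 4 * x - 4) / 4, ?_, ?_, h1, by ring⟩
  · refine (mul_eq_zero.1 (?_ : x ^ 3 * _ = 0)).resolve_left (pow_ne_zero 3 hx)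
    generalize (x ^ 2 + 4 * x - 4) / 4 = d at h1
    have : x ^ 3 * (d ^ 3 + d ^ 2 - 2 * d - 1) = (d * x) ^ 3 + (d * x) ^ 2 * x - 2 * (d * x) * x ^ 2 - x ^ 3 := by ring
    rw [this, h1]
    linear_combination - hQ
  · refine mul_left_cancel₀ (pow_ne_zero 2 hx) ?_
    generalize (x ^ 2 + 4 * x - 4) / 4 = d at h1
    have : x ^ 2 * (2 * d ^ 2 + 2 * d - 4) = 2 * (d * x) ^ 2 + 2 * (d * x) * x - 4 * x ^ 2 := by ring
    rw [this, h1]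
    linear_combination hQ

theorem planar_crit (x w : ℂ) (hx : 7 * x ^ 6 + 2 * x * As (x ^ 2) 1 w = 0)
    (hz : Az (x ^ 2) 1 w = 0) (hw : Aw (x ^ 2) 1 w = 0) : Planar x w := by
  have hf : (x - 1) * (x ^ 3 + 4 * x ^ 2 - 4 * x - 8) ^ 2 -
      (w - 1) * (7 * w * x ^ 2 - 8 * w ^ 3 - 4 * w ^ 2 + 4 * w + 8) ^ 2 = 0 := by
    simp only [As, Az, Aw, Cc, Cz, Cw] at *
    linear_combination (x * hx + hz + w * hw) / 7
  have hx' : x * ((x ^ 3 + 4 * x ^ 2 - 4 * x - 8) * (x ^ 2 + 2 * x - 4) -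
      4 * (w - 1) * w * (7 * w * x ^ 2 - 8 * w ^ 3 - 4 * w ^ 2 + 4 * w + 8)) = 0 := by
    simp only [As, Cc] at hx
    linear_combination hx / 7
  have hw' : (7 * w * x ^ 2 - 8 * w ^ 3 - 4 * w ^ 2 + 4 * w + 8) *
      (x ^ 2 * (3 * w - 2) - 4 * w * (2 * w + 1) * (w - 1)) = 0 := by
    simp only [Aw, Cc, Cw] at hw
    linear_combination - hw / 7
  clear hx hz hw
  by_cases hC : 7 * w * x ^ 2 - 8 * w ^ 3 - 4 * w ^ 2 + 4 * w + 8 = 0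
  · rw [hC] at hf hx'
    have hxQ : (x - 1) * (x ^ 3 + 4 * x ^ 2 - 4 * x - 8) ^ 2 = 0 := by linear_combination hf
    rcases mul_eq_zero.1 hxQ with h | h
    · obtain rfl : x = 1 := by linear_combination h
      norm_num at hx'
    · have hQ := pow_eq_zero_iff (two_ne_zero) |>.1 h
      obtain ⟨d, hd, hxd, -, h4⟩ := root_d x hQ
      refine Or.inr (Or.inr ⟨d, hd, Or.inl ⟨hxd, ?_⟩⟩)
      rw [← hxd]
      have : (w - x) * ((w - (-1 / 2 - d)) * (w - (d - x))) = 0 := by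
        obtain rfl : d = (x ^ 2 + 4 * x - 4) / 4 := by linear_combination h4 / 4
        linear_combination - hC / 8 + ((x ^ 2 - 2 - w * x) / 16) * hQ
      rcases mul_eq_zero.1 this with h | h
      · exact Or.inl (by linear_combination h)
      · rcases mul_eq_zero.1 h with h | h
        · exact Or.inr (Or.inl (by linear_combination h))
        · exact Or.inr (Or.inr (by linear_combination h))
  · have g1 := (mul_eq_zero.1 hw').resolve_left hC
    by_cases hx0 : x = 0
    · subst hx0
      left
      refine ⟨rfl, ?_⟩
      have : w * ((w + 1 / 2) * (w - 1)) = 0 := by linear_combination - g1 / 8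
      rcases mul_eq_zero.1 this with h | h
      · exact h
      · exfalso
        rcases mul_eq_zero.1 h with h | h
        · obtain rfl : w = - 1 / 2 := by linear_combination h
          norm_num at hf
        · obtain rfl : w = 1 := by linear_combination h
          norm_num at hf
    · have g3 := (mul_eq_zero.1 hx').resolve_left hx0
      have hw0 : w ≠ 0 := by
        rintro rfl
        apply hx0
        refine pow_eq_zero_iff (two_ne_zero) |>.1 ?_
        linear_combination - g1 / 2
      have hw1 : w - 1 ≠ 0 := by
        intro h
        obtain rfl : w = 1 := by linear_combination h
        apply hx0
        refine pow_eq_zero_iff (two_ne_zero) |>.1 ?_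
        linear_combination g1
      have hQ : x ^ 3 + 4 * x ^ 2 - 4 * x - 8 ≠ 0 := by
        intro h
        rw [h] at g3
        have : (w - 1) * (w * (7 * w * x ^ 2 - 8 * w ^ 3 - 4 * w ^ 2 + 4 * w + 8)) = 0 := by
          linear_combination - g3 / 4
        exact hC ((mul_eq_zero.1 ((mul_eq_zero.1 this).resolve_left hw1)).resolve_left hw0)
      have g2 : (x ^ 2 + 2 * x - 4) ^ 2 - 16 * (w - 1) * w ^ 2 * (x - 1) = 0 := by
        refine (mul_eq_zero.1 (?_ : (x ^ 3 + 4 * x ^ 2 - 4 * x - 8) ^ 2 * _ = 0)).resolve_left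
          (pow_ne_zero 2 hQ)
        generalize x ^ 3 + 4 * x ^ 2 - 4 * x - 8 = Q at *
        generalize 7 * w * x ^ 2 - 8 * w ^ 3 - 4 * w ^ 2 + 4 * w + 8 = C at *
        linear_combination (Q * (x ^ 2 + 2 * x - 4) + 4 * (w - 1) * w * C) * g3 -
          16 * (w - 1) * w ^ 2 * hf
      rcases mul_eq_zero.1 (planar_h x w g1 g2 g3) with h | h
      · obtain rfl : w = x := by linear_combination h
        refine Or.inr (Or.inl ⟨?_, rfl⟩)
        refine (mul_eq_zero.1 (?_ : w * _ = 0)).resolve_left hx0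
        linear_combination - g1
      · have hx2 : x - 2 ≠ 0 := by
          intro h2
          apply hx0
          linear_combination w * h2 - h
        have e : w * (x - 2) = x := by linear_combination h
        have e4 : (x + 2) * (x ^ 3 - 2 * x ^ 2 - 8 * x + 8) = 0 := by
          refine (mul_eq_zero.1 (?_ : x * _ = 0)).resolve_left hx0
          have : x * ((x + 2) * (x ^ 3 - 2 * x ^ 2 - 8 * x + 8)) =
            x ^ 2 * (3 * x - 2 * (x - 2)) * (x - 2) ^ 2 - 4 * x * (2 * x + (x - 2)) * (x - (x - 2)) := by ring
          rw [this]
          have e' : (x - 2) ^ 3 * (x ^ 2 * (3 * w - 2) - 4 * w * (2 * w + 1) * (w - 1)) =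
            x ^ 2 * (3 * (w * (x - 2)) - 2 * (x - 2)) * (x - 2) ^ 2 -
            4 * (w * (x - 2)) * (2 * (w * (x - 2)) + (x - 2)) * ((w * (x - 2)) - (x - 2)) := by ring
          rw [g1, e, mul_zero] at e'
          exact e'.symm
        rcases mul_eq_zero.1 e4 with h2 | h2
        · exfalso
          obtain rfl : x = -2 := by linear_combination h2
          obtain rfl : w = 1 / 2 := by linear_combination - e / 4
          norm_num at g2
        · obtain ⟨d, hd, hxd, hdx, h4⟩ := root_d (x - 2) (by linear_combination h2)
          refine Or.inr (Or.inr ⟨d, hd, Or.inr ⟨by linear_combination hxd, ?_⟩⟩)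
          refine mul_right_cancel₀ hx2 ?_
          linear_combination e - hdx

end

section
open MvPolynomial

/-- indices of the orbits of nodes off the axis -/
abbrev Kap := (Fin 4 × Fin 3) ⊕ Fin 2
/-- indices of the 99 nodes -/
abbrev Idx := Option (Fin 7 × Kap)

structure RootData (dd : Fin 3 → ℝ) (rr : Fin 2 → ℝ) : Prop where
  hd : ∀ k, dd k ^ 3 + dd k ^ 2 - 2 * dd k - 1 = 0
  dinj : Function.Injective dd
  hr : ∀ k, 5 * rr k ^ 2 - 2 * rr k - 4 = 0
  rinj : Function.Injective rr

theorem exists_rootData : ∃ dd rr, RootData dd rr := by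
  have hc : Continuous fun d : ℝ => d ^ 3 + d ^ 2 - 2 * d - 1 := by fun_prop
  obtain ⟨a, ha, ha0⟩ := intermediate_value_Icc (a := (-2 : ℝ)) (b := -1) (by norm_num) hc.continuousOn
    (show (0 : ℝ) ∈ _ by constructor <;> norm_num)
  obtain ⟨b, hb, hb0⟩ := intermediate_value_Icc' (a := (-1 : ℝ)) (b := 0) (by norm_num) hc.continuousOn
    (show (0 : ℝ) ∈ _ by constructor <;> norm_num)
  obtain ⟨c, hc1, hc0⟩ := intermediate_value_Icc (a := (1 : ℝ)) (b := 2) (by norm_num) hc.continuousOn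
    (show (0 : ℝ) ∈ _ by constructor <;> norm_num)
  simp only [Set.mem_Icc] at ha hb hc1 ha0 hb0 hc0
  have hab : a ≠ b := by
    intro h
    have : a = -1 := by linarith
    rw [this] at ha0
    norm_num at ha0
  have hac : a ≠ c := by intro h; linarith
  have hbc : b ≠ c := by intro h; linarith
  have h21 : (Real.sqrt 21) ^ 2 = 21 := Real.sq_sqrt (by norm_num)
  have h0 : 0 < Real.sqrt 21 := Real.sqrt_pos.2 (by norm_num)
  refine ⟨![a, b, c], ![(1 + Real.sqrt 21) / 5, (1 - Real.sqrt 21) / 5], ?_, ?_, ?_, ?_⟩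
  · intro k
    fin_cases k
    · exact ha0
    · exact hb0
    · exact hc0
  · intro i j h
    fin_cases i <;> fin_cases j <;> simp_all
  · intro k
    fin_cases k
    · simp; linear_combination h21 / 5
    · simp; linear_combination h21 / 5
  · intro i j h
    fin_cases i <;> fin_cases j <;> simp at h ⊢ <;> linarith

/-- x-coordinates of the planar nodes -/
def tx {K : Type*} [Field K] (d : K) : Fin 4 → K :=
  ![2 * d ^ 2 + 2 * d - 4, 2 * d ^ 2 + 2 * d - 4, 2 * d ^ 2 + 2 * d - 4, 2 * d ^ 2 + 2 * d - 4 + 2]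
/-- w-coordinates of the planar nodes -/
def tw {K : Type*} [Field K] (d : K) : Fin 4 → K :=
  ![2 * d ^ 2 + 2 * d - 4, - 1 / 2 - d, d - (2 * d ^ 2 + 2 * d - 4), 1 + d]

noncomputable def kx (dd : Fin 3 → ℝ) (rr : Fin 2 → ℝ) : Kap → ℝ
  | Sum.inl (t, k) => tx (dd k) t
  | Sum.inr e => rr e
noncomputable def kw (dd : Fin 3 → ℝ) (rr : Fin 2 → ℝ) : Kap → ℝ
  | Sum.inl (t, k) => tw (dd k) t
  | Sum.inr e => rr e

/-- a primitive seventh root of unity -/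
noncomputable def zeta : ℂ := Complex.exp (2 * Real.pi * Complex.I / (7 : ℕ))
theorem zeta_prim : IsPrimitiveRoot zeta 7 := Complex.isPrimitiveRoot_exp 7 (by norm_num)

noncomputable def px (dd : Fin 3 → ℝ) (rr : Fin 2 → ℝ) : Idx → ℝ
  | none => 0
  | some (_, a) => kx dd rr a
noncomputable def pw (dd : Fin 3 → ℝ) (rr : Fin 2 → ℝ) : Idx → ℝ
  | none => 0
  | some (_, a) => kw dd rr a
noncomputable def prot : Idx → ℂ
  | none => 1
  | some (j, _) => zeta ^ (j : ℕ)

noncomputable def pt (dd : Fin 3 → ℝ) (rr : Fin 2 → ℝ) (i : Idx) : Fin 4 → ℝ :=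
  ![px dd rr i * (prot i).re, px dd rr i * (prot i).im, 1, pw dd rr i]

theorem kgood {dd rr} (h : RootData dd rr) (a : Kap) : GoodPt (kx dd rr a) (kw dd rr a) := by
  rcases a with ⟨t, k⟩ | e
  · fin_cases t
    · exact good_T1 _ (h.hd k)
    · exact good_T2 _ (h.hd k)
    · exact good_T3 _ (h.hd k)
    · exact good_T4 _ (h.hd k)
  · exact good_T5 _ (h.hr e)

theorem pgood {dd rr} (h : RootData dd rr) (i : Idx) : GoodPt (px dd rr i) (pw dd rr i) := by
  rcases i with _ | ⟨j, a⟩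
  · exact good_axis
  · exact kgood h a

theorem prot_pow (i : Idx) : prot i ^ 7 = 1 := by
  rcases i with _ | ⟨j, a⟩
  · simp [prot]
  · simp only [prot]
    rw [← pow_mul, mul_comm, pow_mul, zeta_prim.pow_eq_one, one_pow]

theorem conj_of_pow (z : ℂ) (hz : z ^ 7 = 1) : z * (starRingEnd ℂ) z = 1 := by
  have h : ‖z‖ = 1 := Complex.norm_eq_one_of_pow_eq_one hz (by norm_num)
  rw [Complex.mul_conj, Complex.normSq_eq_norm_sq, h]
  norm_num

theorem rot_of_pow (z : ℂ) (hz : z ^ 7 = 1) : Rot z.re z.im := by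
  have h1 := conj_of_pow z hz
  have h2 : z ^ 5 = (starRingEnd ℂ) z ^ 2 := by
    linear_combination (starRingEnd ℂ) z ^ 2 * hz -
      z ^ 5 * (z * (starRingEnd ℂ) z + 1) * h1
  obtain ⟨c, s⟩ := z
  simp only [Complex.ext_iff, pow_succ, pow_zero, one_mul, Complex.mul_re, Complex.mul_im, Complex.conj_re, Complex.conj_im,
    Complex.one_re, Complex.one_im] at h1 h2
  obtain ⟨h1, -⟩ := h1
  obtain ⟨h2, h3⟩ := h2
  constructor
  · show c ^ 2 + s ^ 2 = 1
    linear_combination h1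
  · show c ^ 5 - 10 * c ^ 3 * s ^ 2 + 5 * c * s ^ 4 = c ^ 2 - s ^ 2
    linear_combination h2
  · show 5 * c ^ 4 * s - 10 * c ^ 2 * s ^ 3 + s ^ 5 = - 2 * c * s
    linear_combination h3

theorem d_complete {dd rr} (h : RootData dd rr) (d : ℂ) (hd : d ^ 3 + d ^ 2 - 2 * d - 1 = 0) :
    ∃ k, d = (dd k : ℂ) := by
  have h0 := h.hd 0
  have h1 := h.hd 1
  have h2 := h.hd 2
  have n01 : dd 0 - dd 1 ≠ 0 := sub_ne_zero.2 fun e => by simpa using h.dinj e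
  have n02 : dd 0 - dd 2 ≠ 0 := sub_ne_zero.2 fun e => by simpa using h.dinj e
  have n12 : dd 1 - dd 2 ≠ 0 := sub_ne_zero.2 fun e => by simpa using h.dinj e
  have A : dd 0 ^ 2 + dd 0 * dd 1 + dd 1 ^ 2 + dd 0 + dd 1 - 2 = 0 :=
    (mul_eq_zero.1 (by linear_combination h0 - h1 : (dd 0 - dd 1) * _ = 0)).resolve_left n01
  have B : dd 0 ^ 2 + dd 0 * dd 2 + dd 2 ^ 2 + dd 0 + dd 2 - 2 = 0 :=
    (mul_eq_zero.1 (by linear_combination h0 - h2 : (dd 0 - dd 2) * _ = 0)).resolve_left n02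
  have D : dd 0 + dd 1 + dd 2 + 1 = 0 :=
    (mul_eq_zero.1 (by linear_combination A - B : (dd 1 - dd 2) * _ = 0)).resolve_left n12
  have h0' : (dd 0 : ℂ) ^ 3 + (dd 0 : ℂ) ^ 2 - 2 * dd 0 - 1 = 0 := by exact_mod_cast h0
  have A' : (dd 0 : ℂ) ^ 2 + dd 0 * dd 1 + (dd 1 : ℂ) ^ 2 + dd 0 + dd 1 - 2 = 0 := by exact_mod_cast A
  have D' : (dd 0 : ℂ) + dd 1 + dd 2 + 1 = 0 := by exact_mod_cast D
  have : (d - dd 0) * ((d - dd 1) * (d - dd 2)) = 0 := by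
    have e : (dd 2 : ℂ) = - 1 - dd 0 - dd 1 := by linear_combination D'
    rw [e]
    linear_combination hd - h0' + (-(d - (dd 0 : ℂ))) * A'
  rcases mul_eq_zero.1 this with e | e
  · exact ⟨0, by linear_combination e⟩
  · rcases mul_eq_zero.1 e with e | e
    · exact ⟨1, by linear_combination e⟩
    · exact ⟨2, by linear_combination e⟩

theorem r_complete {dd rr} (h : RootData dd rr) (d : ℂ) (hd : 5 * d ^ 2 - 2 * d - 4 = 0) :
    ∃ k, d = (rr k : ℂ) := by
  have h0 := h.hr 0
  have h1 := h.hr 1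
  have n01 : rr 0 - rr 1 ≠ 0 := sub_ne_zero.2 fun e => by simpa using h.rinj e
  have A : 5 * (rr 0 + rr 1) - 2 = 0 :=
    (mul_eq_zero.1 (by linear_combination h0 - h1 : (rr 0 - rr 1) * _ = 0)).resolve_left n01
  have h0' : 5 * (rr 0 : ℂ) ^ 2 - 2 * rr 0 - 4 = 0 := by exact_mod_cast h0
  have A' : 5 * ((rr 0 : ℂ) + rr 1) - 2 = 0 := by exact_mod_cast A
  have : (d - rr 0) * (d - rr 1) = 0 := by
    linear_combination (hd - h0') / 5 - (d - rr 0) * A' / 5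
  rcases mul_eq_zero.1 this with e | e
  · exact ⟨0, by linear_combination e⟩
  · exact ⟨1, by linear_combination e⟩

theorem planar_real {dd rr} (h : RootData dd rr) (x w : ℂ) (hP : Planar x w) :
    (x = 0 ∧ w = 0) ∨ ∃ a : Kap, x = (kx dd rr a : ℂ) ∧ w = (kw dd rr a : ℂ) := by
  rcases hP with h0 | ⟨hr, rfl⟩ | ⟨d, hd, hP⟩
  · exact Or.inl h0
  · obtain ⟨k, hk⟩ := r_complete h w hr
    exact Or.inr ⟨Sum.inr k, hk, hk⟩
  · right
    obtain ⟨k, rfl⟩ := d_complete h d hd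
    rcases hP with ⟨rfl, rfl | rfl | rfl⟩ | ⟨rfl, rfl⟩
    · exact ⟨Sum.inl (0, k), by simp [kx, tx], by simp [kw, tw]⟩
    · exact ⟨Sum.inl (1, k), by simp [kx, tx], by simp [kw, tw]⟩
    · exact ⟨Sum.inl (2, k), by simp [kx, tx], by simp [kw, tw]⟩
    · exact ⟨Sum.inl (3, k), by simp [kx, tx], by simp [kw, tw]⟩

theorem infinity_crit (x w : ℂ) (hz : Az (x ^ 2) 0 w = 0) (hw : Aw (x ^ 2) 0 w = 0) :
    x = 0 ∧ w = 0 := by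
  simp only [Az, Aw, Cc, Cw, Cz] at hz hw
  by_cases w0 : w = 0
  · subst w0
    refine ⟨?_, rfl⟩
    refine pow_eq_zero_iff (n := 6) (by norm_num) |>.1 ?_
    linear_combination hz / 7
  · exfalso
    have : (7 * x ^ 2 - 8 * w ^ 2) * (3 * x ^ 2 - 8 * w ^ 2) = 0 := by
      refine (mul_eq_zero.1 (?_ : w ^ 2 * _ = 0)).resolve_left (pow_ne_zero 2 w0)
      linear_combination - hw / 7
    rcases mul_eq_zero.1 this with e | e
    · have e' : x ^ 2 = 8 / 7 * w ^ 2 := by linear_combination e / 7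
      rw [show x ^ 2 = 8 / 7 * w ^ 2 from e'] at hz
      apply w0
      refine pow_eq_zero_iff (n := 6) (by norm_num) |>.1 ?_
      linear_combination hz / (7 * (8 / 7) ^ 3)
    · have e' : x ^ 2 = 8 / 3 * w ^ 2 := by linear_combination e / 3
      rw [show x ^ 2 = 8 / 3 * w ^ 2 from e'] at hz
      apply w0
      refine pow_eq_zero_iff (n := 6) (by norm_num) |>.1 ?_
      linear_combination hz * 27 / 8960

theorem hall_aux (v : Fin 4 → ℂ)
    (hv : ∀ j, eval v (pderiv j (F0 ℂ)) = 0) :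
    ∃ j : Fin 7, ∃ x : ℂ, v 0 = x * ((zeta ^ (j : ℕ)).re : ℂ) ∧ v 1 = x * ((zeta ^ (j : ℕ)).im : ℂ) ∧
      7 * x ^ 6 + 2 * x * As (x ^ 2) (v 2) (v 3) = 0 ∧ Az (x ^ 2) (v 2) (v 3) = 0 ∧
      Aw (x ^ 2) (v 2) (v 3) = 0 := by
  have h0 := hv 0
  have h1 := hv 1
  have h2 := hv 2
  have h3 := hv 3
  simp only [F0_x, F0_y, F0_z, F0_w, map_add, map_sub, map_mul, map_pow, map_neg, map_ofNat, eval_X,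
    map_As, map_Az, map_Aw] at h0 h1 h2 h3
  generalize v 0 = a at *
  generalize v 1 = b at *
  generalize v 2 = z at *
  generalize v 3 = w at *
  have hI : Complex.I ^ 2 = -1 := Complex.I_sq
  obtain ⟨η, x, hη, hu, hv'⟩ : ∃ η x : ℂ, η ^ 7 = 1 ∧ a + Complex.I * b = η * x ∧
      (a - Complex.I * b) * η = x := by
    generalize As (a ^ 2 + b ^ 2) z w = A at h0 h1
    have k1 : 7 * (a + Complex.I * b) ^ 6 + 2 * (a - Complex.I * b) * A = 0 := by
      linear_combination h0 - Complex.I * h1 + (42 * a * b ^ 5 * Complex.I * (Complex.I ^ 2 - 1) + 105 * a ^ 2 * b ^ 4 * (Complex.I ^ 2 - 1) + 140 * a ^ 3 * b ^ 3 * Complex.I +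
        105 * a ^ 4 * b ^ 2 + 7 * b ^ 6 * (Complex.I ^ 4 - Complex.I ^ 2 + 1)) * hI
    have k2 : 7 * (a - Complex.I * b) ^ 6 + 2 * (a + Complex.I * b) * A = 0 := by
      linear_combination h0 + Complex.I * h1 + (-42 * a * b ^ 5 * Complex.I * (Complex.I ^ 2 - 1) + 105 * a ^ 2 * b ^ 4 * (Complex.I ^ 2 - 1) - 140 * a ^ 3 * b ^ 3 * Complex.I +
        105 * a ^ 4 * b ^ 2 + 7 * b ^ 6 * (Complex.I ^ 4 - Complex.I ^ 2 + 1)) * hI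
    have k3 : (a + Complex.I * b) ^ 7 = (a - Complex.I * b) ^ 7 := by
      linear_combination ((a + Complex.I * b) * k1 - (a - Complex.I * b) * k2) / 7
    generalize a + Complex.I * b = u at *
    generalize a - Complex.I * b = v at *
    by_cases hv0 : v = 0
    · subst hv0
      have : u = 0 := by
        refine pow_eq_zero_iff (n := 7) (by norm_num) |>.1 ?_
        rw [k3]; norm_num
      exact ⟨1, 0, by norm_num, by simp [this], by simp⟩
    · have hq : (u / v) ^ 7 = 1 := by rw [div_pow, k3, div_self (pow_ne_zero 7 hv0)]
      refine ⟨(u / v) ^ 4, v * (u / v) ^ 4, ?_, ?_, rfl⟩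
      · rw [← pow_mul, mul_comm, pow_mul, hq, one_pow]
      · have : u = v * (u / v) := by field_simp
        calc u = v * (u / v) := this
          _ = v * (u / v) * (u / v) ^ 7 := by rw [hq, mul_one]
          _ = _ := by ring
  obtain ⟨j, hj, hjη⟩ := zeta_prim.eq_pow_of_pow_eq_one hη
  have hc := conj_of_pow η hη
  have hη0 : η ≠ 0 := by
    rintro rfl
    norm_num at hη
  have e1 : a + Complex.I * b = η * x := hu
  have e2 : a - Complex.I * b = (starRingEnd ℂ) η * x := by
    linear_combination (starRingEnd ℂ) η * hv' - (a - Complex.I * b) * hc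
  have er : (η.re : ℂ) = (η + (starRingEnd ℂ) η) / 2 := by
    rw [Complex.add_conj]; push_cast; ring
  have ei : Complex.I * (η.im : ℂ) = (η - (starRingEnd ℂ) η) / 2 := by
    rw [Complex.sub_conj]; push_cast; ring
  have ea : a = x * (η.re : ℂ) := by rw [er]; linear_combination (e1 + e2) / 2
  have eb : b = x * (η.im : ℂ) := by
    refine mul_left_cancel₀ Complex.I_ne_zero ?_
    linear_combination (e1 - e2) / 2 - x * ei
  have es : a ^ 2 + b ^ 2 = x ^ 2 := by
    have : a ^ 2 + b ^ 2 = (a + Complex.I * b) * (a - Complex.I * b) := by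
      linear_combination b ^ 2 * hI
    rw [this, e1, e2]
    linear_combination x ^ 2 * hc
  rw [es] at h0 h1 h2 h3
  have hx : 7 * x ^ 6 + 2 * x * As (x ^ 2) z w = 0 := by
    generalize As (x ^ 2) z w = A at h0 h1
    have k1 : 7 * (a + Complex.I * b) ^ 6 + 2 * (a - Complex.I * b) * A = 0 := by
      linear_combination h0 - Complex.I * h1 + (42 * a * b ^ 5 * Complex.I * (Complex.I ^ 2 - 1) + 105 * a ^ 2 * b ^ 4 * (Complex.I ^ 2 - 1) + 140 * a ^ 3 * b ^ 3 * Complex.I +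
        105 * a ^ 4 * b ^ 2 + 7 * b ^ 6 * (Complex.I ^ 4 - Complex.I ^ 2 + 1)) * hI
    rw [e1] at k1
    linear_combination η * k1 - 2 * A * hv' - 7 * x ^ 6 * hη
  refine ⟨⟨j, hj⟩, x, ?_, ?_, hx, h2, h3⟩
  · simp only [hjη]; exact ea
  · simp only [hjη]; exact eb

theorem hall0 {dd rr} (h : RootData dd rr) (v : Fin 4 → ℂ) (hv0 : v ≠ 0)
    (hv : ∀ j, eval v (pderiv j (F0 ℂ)) = 0) : ∃ i, ∃ c : ℂ, v = c • cvec (pt dd rr i) := by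
  obtain ⟨j, x, e0, e1, hx, hz, hw⟩ := hall_aux v hv
  by_cases z0 : v 2 = 0
  · exfalso
    rw [z0] at hz hw
    obtain ⟨rfl, w0⟩ := infinity_crit x (v 3) hz hw
    apply hv0
    ext i
    fin_cases i
    · simpa using e0
    · simpa using e1
    · exact z0
    · exact w0
  · have ex : x = v 2 * (x / v 2) := by field_simp
    have ew : v 3 = v 2 * (v 3 / v 2) := by field_simp
    generalize x / v 2 = x' at ex
    generalize v 3 / v 2 = w' at ew
    rw [ex, ew] at hx hz hw
    generalize hzz : v 2 = z at *
    have hP : Planar x' w' := by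
      apply planar_crit
      · refine (mul_eq_zero.1 (?_ : z ^ 6 * _ = 0)).resolve_left (pow_ne_zero 6 z0)
        simp only [As, Cc] at hx ⊢
        linear_combination hx
      · refine (mul_eq_zero.1 (?_ : z ^ 6 * _ = 0)).resolve_left (pow_ne_zero 6 z0)
        simp only [Az, Cc, Cz] at hz ⊢
        linear_combination hz
      · refine (mul_eq_zero.1 (?_ : z ^ 6 * _ = 0)).resolve_left (pow_ne_zero 6 z0)
        simp only [Aw, Cc, Cw] at hw ⊢
        linear_combination hw
    rcases planar_real h x' w' hP with ⟨rfl, rfl⟩ | ⟨a, rfl, rfl⟩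
    · refine ⟨none, z, ?_⟩
      rw [mul_zero] at ex ew
      subst ex
      ext i
      fin_cases i
      · simpa [cvec, pt, px] using e0
      · simpa [cvec, pt, px] using e1
      · simpa [cvec, pt] using hzz
      · simpa [cvec, pt, pw] using ew
    · refine ⟨some (j, a), z, ?_⟩
      ext i
      fin_cases i
      · simp [cvec, pt, px, prot, e0, ex]; ring
      · simp [cvec, pt, px, prot, e1, ex]; ring
      · simpa [cvec, pt] using hzz
      · simpa [cvec, pt, pw] using ew

end

section
open MvPolynomial

/-- columns: basis of the coordinate algebra of the planar nodes together with the axis node -/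
abbrev Col := Option Kap

def k3mul (p q : ℤ × ℤ × ℤ) : ℤ × ℤ × ℤ :=
  (p.1 * q.1 + (p.2.1 * q.2.2 + p.2.2 * q.2.1) - p.2.2 * q.2.2,
   p.1 * q.2.1 + p.2.1 * q.1 + 2 * (p.2.1 * q.2.2 + p.2.2 * q.2.1) - p.2.2 * q.2.2,
   p.1 * q.2.2 + p.2.1 * q.2.1 + p.2.2 * q.1 - (p.2.1 * q.2.2 + p.2.2 * q.2.1) + 3 * (p.2.2 * q.2.2))
def k3pow (p : ℤ × ℤ × ℤ) : ℕ → ℤ × ℤ × ℤ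
  | 0 => (1, 0, 0)
  | n + 1 => k3mul (k3pow p n) p
def k2pow : ℕ → ℤ × ℤ
  | 0 => (1, 0)
  | n + 1 => (80 * (k2pow n).2, (k2pow n).1 + 4 * (k2pow n).2)
def k3c (p : ℤ × ℤ × ℤ) : Fin 3 → ℤ := ![p.1, p.2.1, p.2.2]
def k2c (p : ℤ × ℤ) : Fin 2 → ℤ := ![p.1, p.2]
def KX : Fin 4 → ℤ × ℤ × ℤ := ![(-40, 20, 20), (-40, 20, 20), (-40, 20, 20), (-20, 20, 20)]
def KW : Fin 4 → ℤ × ℤ × ℤ := ![(-40, 20, 20), (-5, -10, 0), (40, -10, -20), (10, 10, 0)]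

def ent (n e : ℕ) : Col → ℤ
  | some (Sum.inl (t, i)) => k3c (k3mul (k3pow (KX t) n) (k3pow (KW t) e)) i
  | some (Sum.inr i) => k2c (k2pow (n + e)) i
  | none => if n + e = 0 then 1 else 0

def cidx : Col → ℕ
  | some (Sum.inl (t, i)) => 3 * t + i
  | some (Sum.inr i) => 12 + i
  | none => 14

def rowL : List (List (ℕ × ℕ × ℕ)) := [
  [(0, 0, 0),
    (0, 0, 1),
    (0, 0, 2),
    (0, 0, 3),
    (0, 0, 4),
    (0, 0, 5),
    (0, 0, 6),
    (0, 0, 7),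
    (1, 1, 0),
    (1, 1, 1),
    (1, 1, 2),
    (1, 1, 3),
    (1, 1, 4),
    (1, 1, 5),
    (2, 2, 0)],
  [(0, 0, 0),
    (1, 0, 0),
    (1, 0, 1),
    (1, 0, 2),
    (1, 0, 3),
    (1, 0, 4),
    (1, 0, 5),
    (1, 0, 6),
    (2, 1, 0),
    (2, 1, 1),
    (2, 1, 2),
    (2, 1, 3),
    (2, 1, 4),
    (3, 2, 0),
    (3, 2, 1)],
  [(0, 0, 0),
    (2, 0, 0),
    (2, 0, 1),
    (2, 0, 2),
    (2, 0, 3),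
    (2, 0, 4),
    (2, 0, 5),
    (3, 1, 0),
    (3, 1, 1),
    (3, 1, 2),
    (3, 1, 3),
    (0, 5, 0),
    (0, 5, 1),
    (0, 5, 2),
    (4, 2, 0)],
  [(0, 0, 0),
    (3, 0, 0),
    (3, 0, 1),
    (3, 0, 2),
    (3, 0, 3),
    (3, 0, 4),
    (0, 4, 0),
    (0, 4, 1),
    (0, 4, 2),
    (0, 4, 3),
    (4, 1, 0),
    (4, 1, 1),
    (4, 1, 2),
    (1, 5, 0),
    (1, 5, 1)]]
def tabM : List (List (List ℤ)) := [
  [[1, 0, 0, 1, 0, 0, 1, 0, 0, 1, 0, 0, 1, 0, 1],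
    [4, 9, 9, 6, 1, 0, 7, 1, 2, 10, 10, 0, 0, 1, 0],
    [9, 7, 3, 3, 1, 1, 5, 7, 4, 1, 2, 1, 3, 4, 0],
    [0, 9, 4, 8, 0, 6, 1, 5, 7, 9, 6, 9, 1, 8, 0],
    [4, 3, 0, 10, 9, 8, 10, 1, 4, 4, 0, 5, 2, 0, 0],
    [10, 3, 3, 2, 3, 5, 2, 10, 1, 2, 8, 0, 0, 2, 0],
    [1, 7, 2, 6, 8, 6, 0, 2, 6, 9, 1, 3, 6, 8, 0],
    [1, 5, 9, 9, 0, 5, 9, 0, 4, 10, 6, 10, 2, 5, 0],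
    [9, 7, 3, 9, 7, 3, 9, 7, 3, 8, 4, 0, 3, 4, 0],
    [0, 9, 4, 2, 2, 0, 8, 9, 3, 3, 10, 7, 1, 8, 0],
    [4, 3, 0, 1, 3, 2, 5, 8, 10, 1, 6, 1, 2, 0, 0],
    [10, 3, 3, 8, 1, 2, 8, 5, 1, 9, 2, 5, 0, 2, 0],
    [1, 7, 2, 6, 7, 0, 10, 8, 1, 8, 1, 9, 6, 8, 0],
    [1, 5, 9, 3, 4, 7, 8, 10, 2, 5, 6, 10, 2, 5, 0],
    [4, 3, 0, 4, 3, 0, 4, 3, 0, 9, 9, 5, 2, 0, 0]],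
  [[1, 0, 0, 1, 0, 0, 1, 0, 0, 1, 0, 0, 1, 0, 1],
    [4, 9, 9, 4, 9, 9, 4, 9, 9, 2, 9, 9, 0, 1, 0],
    [9, 7, 3, 0, 10, 10, 4, 4, 8, 0, 4, 2, 3, 4, 0],
    [0, 9, 4, 10, 3, 5, 6, 4, 1, 9, 3, 7, 1, 8, 0],
    [4, 3, 0, 10, 5, 6, 5, 6, 9, 6, 7, 8, 2, 0, 0],
    [10, 3, 3, 0, 8, 2, 5, 5, 2, 8, 4, 4, 0, 2, 0],
    [1, 7, 2, 2, 8, 7, 10, 5, 7, 10, 2, 7, 6, 8, 0],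
    [1, 5, 9, 8, 9, 10, 7, 10, 0, 5, 7, 9, 2, 5, 0],
    [0, 9, 4, 0, 9, 4, 0, 9, 4, 8, 9, 6, 1, 8, 0],
    [4, 3, 0, 4, 7, 7, 3, 0, 6, 8, 4, 2, 2, 0, 0],
    [10, 3, 3, 9, 5, 9, 4, 3, 1, 1, 6, 7, 0, 2, 0],
    [1, 7, 2, 8, 2, 6, 0, 4, 6, 3, 1, 5, 6, 8, 0],
    [1, 5, 9, 10, 10, 10, 2, 0, 2, 3, 8, 10, 2, 5, 0],
    [10, 3, 3, 10, 3, 3, 10, 3, 3, 0, 9, 5, 0, 2, 0],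
    [1, 7, 2, 8, 1, 7, 7, 10, 9, 6, 3, 2, 6, 8, 0]],
  [[1, 0, 0, 1, 0, 0, 1, 0, 0, 1, 0, 0, 1, 0, 1],
    [9, 7, 3, 9, 7, 3, 9, 7, 3, 8, 4, 0, 3, 4, 0],
    [0, 9, 4, 2, 2, 0, 8, 9, 3, 3, 10, 7, 1, 8, 0],
    [4, 3, 0, 1, 3, 2, 5, 8, 10, 1, 6, 1, 2, 0, 0],
    [10, 3, 3, 8, 1, 2, 8, 5, 1, 9, 2, 5, 0, 2, 0],
    [1, 7, 2, 6, 7, 0, 10, 8, 1, 8, 1, 9, 6, 8, 0],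
    [1, 5, 9, 3, 4, 7, 8, 10, 2, 5, 6, 10, 2, 5, 0],
    [4, 3, 0, 4, 3, 0, 4, 3, 0, 9, 9, 5, 2, 0, 0],
    [10, 3, 3, 2, 0, 3, 1, 4, 5, 8, 5, 2, 0, 2, 0],
    [1, 7, 2, 4, 8, 4, 10, 1, 3, 1, 5, 6, 6, 8, 0],
    [1, 5, 9, 6, 5, 6, 3, 10, 0, 4, 4, 6, 2, 5, 0],
    [10, 3, 3, 10, 3, 3, 10, 3, 3, 0, 9, 5, 0, 2, 0],
    [1, 7, 2, 8, 1, 7, 7, 10, 9, 6, 3, 2, 6, 8, 0],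
    [1, 5, 9, 0, 6, 3, 5, 7, 2, 3, 9, 8, 2, 5, 0],
    [1, 7, 2, 1, 7, 2, 1, 7, 2, 4, 5, 1, 6, 8, 0]],
  [[1, 0, 0, 1, 0, 0, 1, 0, 0, 1, 0, 0, 1, 0, 1],
    [0, 9, 4, 0, 9, 4, 0, 9, 4, 8, 9, 6, 1, 8, 0],
    [4, 3, 0, 4, 7, 7, 3, 0, 6, 8, 4, 2, 2, 0, 0],
    [10, 3, 3, 9, 5, 9, 4, 3, 1, 1, 6, 7, 0, 2, 0],
    [1, 7, 2, 8, 2, 6, 0, 4, 6, 3, 1, 5, 6, 8, 0],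
    [1, 5, 9, 10, 10, 10, 2, 0, 2, 3, 8, 10, 2, 5, 0],
    [4, 3, 0, 4, 3, 0, 4, 3, 0, 9, 9, 5, 2, 0, 0],
    [10, 3, 3, 2, 0, 3, 1, 4, 5, 8, 5, 2, 0, 2, 0],
    [1, 7, 2, 4, 8, 4, 10, 1, 3, 1, 5, 6, 6, 8, 0],
    [1, 5, 9, 6, 5, 6, 3, 10, 0, 4, 4, 6, 2, 5, 0],
    [10, 3, 3, 10, 3, 3, 10, 3, 3, 0, 9, 5, 0, 2, 0],
    [1, 7, 2, 8, 1, 7, 7, 10, 9, 6, 3, 2, 6, 8, 0],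
    [1, 5, 9, 0, 6, 3, 5, 7, 2, 3, 9, 8, 2, 5, 0],
    [1, 7, 2, 1, 7, 2, 1, 7, 2, 4, 5, 1, 6, 8, 0],
    [1, 5, 9, 8, 3, 6, 8, 1, 8, 6, 0, 6, 2, 5, 0]]]
def tabB : List (List (List ℤ)) := [
  [[0, 5, 4, 2, 6, 2, 6, 4, 7, 8, 9, 6, 8, 4, 7],
    [0, 9, 2, 10, 7, 7, 3, 4, 2, 7, 0, 6, 0, 0, 4],
    [0, 1, 4, 1, 6, 2, 10, 1, 9, 2, 10, 5, 4, 9, 10],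
    [0, 2, 8, 8, 0, 2, 9, 1, 6, 6, 4, 0, 10, 2, 7],
    [0, 8, 8, 0, 5, 1, 6, 0, 6, 10, 9, 9, 1, 0, 5],
    [0, 2, 3, 7, 8, 4, 5, 10, 1, 6, 7, 10, 7, 9, 0],
    [0, 6, 9, 4, 0, 10, 8, 8, 3, 2, 9, 10, 6, 5, 3],
    [0, 4, 4, 6, 4, 5, 2, 0, 0, 2, 1, 8, 6, 7, 9],
    [0, 1, 6, 1, 0, 10, 7, 0, 1, 6, 8, 2, 8, 7, 3],
    [0, 9, 4, 4, 2, 4, 0, 8, 8, 0, 0, 9, 8, 9, 3],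
    [0, 7, 3, 5, 1, 6, 9, 8, 2, 0, 1, 1, 8, 8, 9],
    [0, 10, 2, 5, 7, 8, 0, 9, 1, 0, 1, 1, 3, 1, 10],
    [0, 5, 5, 5, 10, 3, 7, 0, 2, 0, 0, 7, 5, 4, 9],
    [0, 4, 0, 5, 7, 0, 0, 3, 5, 0, 4, 5, 10, 6, 6],
    [1, 6, 3, 10, 4, 1, 3, 1, 7, 6, 0, 1, 7, 9, 4]],
  [[0, 1, 3, 10, 2, 10, 7, 6, 7, 1, 10, 9, 8, 4, 7],
    [0, 6, 8, 5, 10, 10, 5, 2, 10, 2, 6, 9, 7, 8, 0],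
    [0, 2, 9, 10, 10, 4, 9, 7, 0, 5, 8, 1, 10, 7, 8],
    [0, 0, 7, 7, 0, 3, 5, 8, 8, 6, 1, 1, 5, 3, 0],
    [0, 0, 1, 0, 9, 5, 7, 9, 10, 6, 8, 6, 7, 10, 2],
    [0, 0, 10, 3, 2, 3, 4, 2, 9, 5, 8, 7, 4, 10, 7],
    [0, 6, 3, 1, 9, 9, 7, 1, 3, 0, 0, 2, 0, 2, 2],
    [0, 6, 10, 0, 6, 0, 10, 4, 8, 9, 2, 5, 10, 5, 2],
    [0, 6, 10, 2, 9, 1, 4, 1, 6, 6, 6, 5, 2, 0, 8],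
    [0, 4, 10, 7, 6, 5, 10, 10, 6, 10, 3, 8, 5, 0, 3],
    [0, 8, 8, 2, 9, 5, 0, 2, 3, 8, 10, 9, 1, 0, 7],
    [0, 1, 4, 10, 4, 4, 9, 2, 0, 6, 5, 5, 1, 0, 0],
    [0, 6, 0, 3, 10, 7, 7, 1, 1, 8, 1, 2, 6, 0, 6],
    [0, 1, 4, 0, 7, 10, 0, 0, 8, 2, 1, 8, 0, 0, 4],
    [1, 5, 10, 5, 6, 10, 8, 7, 8, 8, 7, 0, 9, 2, 4]],
  [[0, 0, 6, 9, 1, 1, 5, 10, 5, 0, 8, 10, 10, 3, 2],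
    [0, 3, 2, 2, 7, 0, 8, 4, 9, 3, 6, 6, 4, 6, 10],
    [0, 0, 2, 0, 4, 6, 0, 2, 4, 6, 9, 3, 4, 8, 3],
    [0, 9, 2, 9, 2, 0, 3, 5, 1, 6, 5, 6, 5, 4, 3],
    [0, 8, 3, 0, 1, 10, 2, 10, 0, 10, 9, 7, 4, 7, 8],
    [0, 5, 6, 8, 9, 5, 5, 1, 1, 3, 2, 6, 5, 7, 7],
    [0, 6, 5, 6, 0, 1, 9, 7, 1, 5, 6, 5, 1, 4, 6],
    [0, 4, 7, 5, 9, 4, 8, 0, 7, 5, 3, 10, 1, 9, 6],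
    [0, 7, 4, 5, 6, 3, 6, 1, 8, 9, 0, 4, 2, 7, 3],
    [0, 5, 6, 10, 1, 7, 9, 10, 7, 0, 5, 8, 6, 0, 7],
    [0, 3, 8, 9, 3, 7, 9, 3, 8, 5, 6, 3, 7, 0, 4],
    [0, 2, 9, 7, 3, 7, 0, 1, 6, 4, 10, 4, 10, 0, 9],
    [0, 0, 8, 9, 9, 10, 1, 1, 6, 1, 9, 7, 3, 0, 2],
    [0, 9, 0, 1, 9, 9, 7, 1, 8, 7, 2, 5, 4, 0, 3],
    [1, 2, 6, 1, 9, 3, 6, 0, 2, 10, 0, 8, 8, 0, 2]],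
  [[0, 6, 4, 9, 6, 7, 4, 10, 4, 1, 8, 3, 7, 0, 1],
    [0, 5, 5, 2, 6, 6, 0, 2, 7, 9, 4, 8, 8, 6, 4],
    [0, 2, 2, 9, 4, 8, 0, 1, 2, 1, 1, 0, 5, 2, 3],
    [0, 0, 6, 3, 2, 7, 5, 10, 7, 2, 9, 6, 10, 7, 3],
    [0, 0, 4, 2, 5, 8, 7, 5, 10, 7, 4, 6, 7, 1, 0],
    [0, 0, 3, 2, 6, 2, 8, 8, 6, 10, 1, 1, 5, 9, 5],
    [0, 0, 10, 10, 0, 10, 1, 5, 6, 7, 7, 9, 6, 7, 10],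
    [0, 0, 10, 0, 10, 7, 1, 0, 1, 3, 0, 10, 1, 1, 0],
    [0, 0, 6, 6, 6, 8, 5, 9, 10, 8, 7, 6, 10, 0, 7],
    [0, 0, 9, 8, 3, 2, 2, 1, 0, 0, 2, 3, 1, 5, 8],
    [0, 0, 2, 7, 6, 5, 9, 8, 10, 2, 7, 5, 8, 1, 7],
    [0, 0, 8, 9, 8, 1, 3, 6, 2, 7, 7, 0, 6, 1, 8],
    [0, 8, 5, 3, 2, 2, 5, 5, 10, 2, 3, 2, 1, 2, 5],
    [0, 9, 2, 8, 6, 0, 8, 1, 9, 4, 4, 6, 0, 10, 4],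
    [1, 8, 10, 0, 9, 5, 5, 2, 6, 10, 4, 10, 8, 1, 6]]]

def row (m : Fin 4) (r : Col) : ℕ × ℕ × ℕ := (rowL.getD m []).getD (cidx r) (0, 0, 0)
def litM (m : Fin 4) (r c : Col) : ℤ := ((tabM.getD m []).getD (cidx r) []).getD (cidx c) 0
def litB (m : Fin 4) (r c : Col) : ℤ := ((tabB.getD m []).getD (cidx r) []).getD (cidx c) 0

def matM (m : Fin 4) : Matrix Col Col ℤ := Matrix.of fun r c =>
  ent ((row m r).1 + (row m r).2.1) (row m r).2.2 c
def matB (m : Fin 4) : Matrix Col Col ℤ := Matrix.of fun r c => litB m r c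

theorem chk_row : ∀ (m : Fin 4) (r : Col), cidx r ≠ 0 →
    ((row m r).1 + 6 * (row m r).2.1) % 7 = (m : ℕ) ∧
    (row m r).1 + (row m r).2.1 + (row m r).2.2 ≤ 7 ∧
    ((m : ℕ) ≠ 0 → (row m r).1 + (row m r).2.1 ≠ 0) := by decide +kernel
theorem chk_row0 : ∀ (m : Fin 4), row m (some (Sum.inl (0, 0))) = (0, 0, 0) := by decide +kernel
theorem cidx_zero : ∀ r : Col, cidx r = 0 → r = some (Sum.inl (0, 0)) := by decide +kernel
theorem chk_M : ∀ (m : Fin 4) (r c : Col), matM m r c % 11 = litM m r c := by decide +kernel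
theorem chk_B : ∀ (m : Fin 4) (r c : Col), (∑ k, litB m r k * litM m k c) % 11 =
    if r = c then 1 else 0 := by decide +kernel

end

section
open MvPolynomial

theorem matM_mulVec (m : Fin 4) (μ : Col → ℂ)
    (h : ∀ r, ∑ c, ((matM m r c : ℤ) : ℂ) * μ c = 0) : μ = 0 := by
  have h1 : (matB m).map (Int.castRingHom (ZMod 11)) * (matM m).map (Int.castRingHom (ZMod 11)) = 1 := by
    ext r c
    have e := chk_B m r c
    have e' : (((∑ k, litB m r k * litM m k c) % 11 : ℤ) : ZMod 11) = if r = c then 1 else 0 := by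
      rw [e]; split_ifs <;> simp
    have mod : ∀ a : ℤ, ((a % 11 : ℤ) : ZMod 11) = (a : ZMod 11) := fun a =>
      (ZMod.intCast_mod a 11)
    rw [mod] at e'
    rw [Matrix.mul_apply, Matrix.one_apply, ← e', Int.cast_sum]
    refine Finset.sum_congr rfl fun k _ => ?_
    rw [Int.cast_mul, ← chk_M m k c, mod]
    rfl
  have hdet : (matM m).det ≠ 0 := by
    intro h0
    have h2 := congrArg Matrix.det h1
    rw [Matrix.det_mul, Matrix.det_one] at h2
    have h3 : ((matM m).map (Int.castRingHom (ZMod 11))).det = 0 := by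
      have := RingHom.map_det (Int.castRingHom (ZMod 11)) (matM m)
      rw [h0, map_zero] at this
      exact this.symm
    rw [h3, mul_zero] at h2
    exact absurd h2 (by decide)
  have hdetC : ((matM m).map (Int.castRingHom ℂ)).det ≠ 0 := by
    have := RingHom.map_det (Int.castRingHom ℂ) (matM m)
    intro h0
    rw [RingHom.mapMatrix_apply, h0] at this
    apply hdet
    have h4 : (((matM m).det : ℤ) : ℂ) = 0 := this
    exact_mod_cast h4
  refine Matrix.eq_zero_of_mulVec_eq_zero hdetC ?_
  ext r
  exact h r

/-- evaluation of a cubic field element -/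
noncomputable def phi3 (d : ℂ) (p : ℤ × ℤ × ℤ) : ℂ := p.1 + p.2.1 * d + p.2.2 * d ^ 2
noncomputable def phi2 (d : ℂ) (p : ℤ × ℤ) : ℂ := p.1 + p.2 * d

theorem phi3_mul (d : ℂ) (hd : d ^ 3 + d ^ 2 - 2 * d - 1 = 0) (p q : ℤ × ℤ × ℤ) :
    phi3 d (k3mul p q) = phi3 d p * phi3 d q := by
  simp only [phi3, k3mul]
  push_cast
  linear_combination (-((p.2.1 * q.2.2 + p.2.2 * q.2.1 : ℂ)) - p.2.2 * q.2.2 * (d - 1)) * hd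

theorem phi3_pow (d : ℂ) (hd : d ^ 3 + d ^ 2 - 2 * d - 1 = 0) (p : ℤ × ℤ × ℤ) (n : ℕ) :
    phi3 d (k3pow p n) = phi3 d p ^ n := by
  induction n with
  | zero => simp [phi3, k3pow]
  | succ n ih => rw [k3pow, phi3_mul d hd, ih, pow_succ]

theorem phi2_pow (d : ℂ) (hd : d ^ 2 = 4 * d + 80) (n : ℕ) : phi2 d (k2pow n) = d ^ n := by
  induction n with
  | zero => simp [phi2, k2pow]
  | succ n ih =>
    rw [pow_succ, ← ih]
    simp only [phi2, k2pow]
    push_cast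
    linear_combination - ((k2pow n).2 : ℂ) * hd

theorem phi3_KX (d : ℂ) (t : Fin 4) : phi3 d (KX t) = 10 * tx d t := by
  fin_cases t <;> simp [phi3, KX, tx] <;> ring
theorem phi3_KW (d : ℂ) (t : Fin 4) : phi3 d (KW t) = 10 * tw d t := by
  fin_cases t <;> simp [phi3, KW, tw] <;> ring

theorem sum3 (P : ℤ × ℤ × ℤ) (L d : Fin 3 → ℂ) :
    ∑ i : Fin 3, ((k3c P i : ℤ) : ℂ) * ∑ k, L k * d k ^ (i : ℕ) = ∑ k, L k * phi3 (d k) P := by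
  simp [Fin.sum_univ_three, k3c, phi3]
  ring
theorem sum2 (P : ℤ × ℤ) (L d : Fin 2 → ℂ) :
    ∑ i : Fin 2, ((k2c P i : ℤ) : ℂ) * ∑ k, L k * d k ^ (i : ℕ) = ∑ k, L k * phi2 (d k) P := by
  simp [Fin.sum_univ_two, k2c, phi2]
  ring

theorem tx_cast (d : ℝ) (t : Fin 4) : ((tx d t : ℝ) : ℂ) = tx (d : ℂ) t := by
  fin_cases t <;> simp [tx]
theorem tw_cast (d : ℝ) (t : Fin 4) : ((tw d t : ℝ) : ℂ) = tw (d : ℂ) t := by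
  fin_cases t <;> simp [tw]

/-- moments -/
noncomputable def mom (dd : Fin 3 → ℝ) (rr : Fin 2 → ℝ) (Lam : Kap → ℂ) (L0 : ℂ) : Col → ℂ
  | some (Sum.inl (t, i)) => ∑ k, Lam (Sum.inl (t, k)) * (dd k : ℂ) ^ (i : ℕ)
  | some (Sum.inr i) => ∑ k, Lam (Sum.inr k) * (10 * (rr k : ℂ)) ^ (i : ℕ)
  | none => L0

theorem mom_sum {dd rr} (h : RootData dd rr) (Lam : Kap → ℂ) (L0 : ℂ) (n e : ℕ) :
    ∑ c, ((ent n e c : ℤ) : ℂ) * mom dd rr Lam L0 c =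
      10 ^ (n + e) * (L0 * 0 ^ (n + e) + ∑ a, Lam a * ((kx dd rr a : ℂ) ^ n * (kw dd rr a : ℂ) ^ e)) := by
  have hd : ∀ k, (dd k : ℂ) ^ 3 + (dd k : ℂ) ^ 2 - 2 * dd k - 1 = 0 := fun k => by
    exact_mod_cast h.hd k
  have hr : ∀ k, (10 * (rr k : ℂ)) ^ 2 = 4 * (10 * (rr k : ℂ)) + 80 := fun k => by
    have : 5 * (rr k : ℂ) ^ 2 - 2 * rr k - 4 = 0 := by exact_mod_cast h.hr k
    linear_combination 20 * this
  rw [Fintype.sum_option, Fintype.sum_sum_type, Fintype.sum_sum_type, Fintype.sum_prod_type,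
    Fintype.sum_prod_type, mul_add, mul_add]
  congr 1
  · simp only [ent, mom]
    by_cases h0 : n + e = 0
    · simp [h0]
    · rw [if_neg h0, zero_pow h0]; simp
  congr 1
  · rw [Finset.mul_sum]
    refine Finset.sum_congr rfl fun t _ => ?_
    simp only [ent, mom]
    rw [sum3, Finset.mul_sum]
    refine Finset.sum_congr rfl fun k _ => ?_
    rw [phi3_mul _ (hd k), phi3_pow _ (hd k), phi3_pow _ (hd k), phi3_KX, phi3_KW]
    simp only [kx, kw, tx_cast, tw_cast]
    rw [mul_pow, mul_pow, pow_add]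
    ring
  · simp only [ent, mom]
    rw [sum2 _ _ (fun k => 10 * (rr k : ℂ)), Finset.mul_sum]
    refine Finset.sum_congr rfl fun k _ => ?_
    rw [phi2_pow _ (hr k), mul_pow]
    simp only [kx, kw]
    ring

theorem mom_zero {dd rr} (h : RootData dd rr) (Lam : Kap → ℂ) (L0 : ℂ)
    (h0 : mom dd rr Lam L0 = 0) : Lam = 0 ∧ L0 = 0 := by
  refine ⟨?_, congrFun h0 none⟩
  have i1 : Function.Injective fun k => (dd k : ℂ) := fun a b hab =>
    h.dinj (Complex.ofReal_injective hab)
  have i2 : Function.Injective fun k => 10 * (rr k : ℂ) := fun a b hab =>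
    h.rinj (by
      have : (10 : ℂ) * rr a = 10 * rr b := hab
      have := mul_left_cancel₀ (by norm_num : (10 : ℂ) ≠ 0) this
      exact_mod_cast this)
  ext a
  rcases a with ⟨t, k⟩ | k
  · have := Matrix.eq_zero_of_forall_pow_sum_mul_pow_eq_zero (v := fun k => Lam (Sum.inl (t, k))) i1
      (fun i => congrFun h0 (some (Sum.inl (t, i))))
    exact congrFun this k
  · have := Matrix.eq_zero_of_forall_pow_sum_mul_pow_eq_zero (v := fun k => Lam (Sum.inr k)) i2
      (fun i => congrFun h0 (some (Sum.inr i)))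
    exact congrFun this k

theorem indep {dd rr} (h : RootData dd rr) (m : Fin 4) (Lam : Kap → ℂ) (L0 : ℂ)
    (hL : ∀ r : Col, cidx r ≠ 0 ∨ (m : ℕ) = 0 →
      L0 * 0 ^ ((row m r).1 + (row m r).2.1 + (row m r).2.2) +
      ∑ a, Lam a * ((kx dd rr a : ℂ) ^ ((row m r).1 + (row m r).2.1) *
        (kw dd rr a : ℂ) ^ (row m r).2.2) = 0) : Lam = 0 ∧ ((m : ℕ) = 0 → L0 = 0) := by
  by_cases hm : (m : ℕ) = 0
  · have := mom_zero h Lam L0 (matM_mulVec m _ fun r => by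
      have := mom_sum h Lam L0 ((row m r).1 + (row m r).2.1) (row m r).2.2
      rw [hL r (Or.inr hm), mul_zero] at this
      exact this)
    exact ⟨this.1, fun _ => this.2⟩
  · have := mom_zero h Lam (- ∑ a, Lam a) (matM_mulVec m _ fun r => by
      have := mom_sum h Lam (- ∑ a, Lam a) ((row m r).1 + (row m r).2.1) (row m r).2.2
      refine this.trans ?_
      by_cases hr : cidx r = 0
      · rw [cidx_zero r hr, chk_row0]
        simp
      · have h1 := hL r (Or.inl hr)
        have h2 := (chk_row m r hr).2.2 hm
        have h3 : (row m r).1 + (row m r).2.1 + (row m r).2.2 ≠ 0 := by omega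
        rw [zero_pow h3, mul_zero] at h1 ⊢
        rw [h1, mul_zero])
    exact ⟨this.1, fun h => absurd h hm⟩

/-- complex test septics -/
theorem test_complex (p : Idx → Fin 4 → ℝ) (lam : Idx → ℝ)
    (hl : ∀ G : MvPolynomial (Fin 4) ℝ, G.IsHomogeneous 7 → ∑ i, lam i * eval (p i) G = 0)
    (G : MvPolynomial (Fin 4) ℂ) (hG : G.IsHomogeneous 7) :
    ∑ i, (lam i : ℂ) * eval (cvec (p i)) G = 0 := by
  simp only [eval_eq', Finset.mul_sum]
  rw [Finset.sum_comm]
  refine Finset.sum_eq_zero fun d hd => ?_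
  have hdeg : d.degree = 7 := by
    by_contra hne
    exact (mem_support_iff.1 hd) (hG.coeff_eq_zero hne)
  have := hl (monomial d 1) (isHomogeneous_monomial 1 hdeg)
  have h2 : ∑ i, (lam i : ℂ) * ∏ j, cvec (p i) j ^ d j = 0 := by
    have h3 : ((∑ i, lam i * eval (p i) (monomial d (1 : ℝ)) : ℝ) : ℂ) = 0 := by rw [this]; simp
    rw [← h3]
    push_cast
    refine Finset.sum_congr rfl fun i _ => ?_
    rw [eval_monomial, one_mul, Finsupp.prod_fintype _ _ (by simp)]
    push_cast
    rfl
  have h4 : ∀ i, (lam i : ℂ) * (coeff d G * ∏ j, cvec (p i) j ^ d j) =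
      coeff d G * ((lam i : ℂ) * ∏ j, cvec (p i) j ^ d j) := fun i => by ring
  simp only [h4]
  rw [← Finset.mul_sum, h2, mul_zero]

theorem test_ab {dd rr} (lam : Idx → ℝ)
    (hl : ∀ G : MvPolynomial (Fin 4) ℝ, G.IsHomogeneous 7 → ∑ i, lam i * eval (pt dd rr i) G = 0)
    (a b e : ℕ) (hab : a + b + e ≤ 7) :
    ∑ i, (lam i : ℂ) * ((px dd rr i : ℂ) ^ (a + b) * (pw dd rr i : ℂ) ^ e * prot i ^ (a + 6 * b)) = 0 := by
  have hX : ∀ i : Fin 4, (X i : MvPolynomial (Fin 4) ℂ).IsHomogeneous 1 := isHomogeneous_X ℂ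
  have hCX : (C Complex.I * X 1 : MvPolynomial (Fin 4) ℂ).IsHomogeneous 1 := by
    simpa using (isHomogeneous_C (Fin 4) Complex.I).mul (hX 1)
  have hG : ((X 0 + C Complex.I * X 1) ^ a * (X 0 - C Complex.I * X 1) ^ b * X 3 ^ e *
      X 2 ^ (7 - (a + b + e)) : MvPolynomial (Fin 4) ℂ).IsHomogeneous 7 := by
    refine hom_cast (((((hX 0).add hCX).pow a).mul (((hX 0).sub hCX).pow b)).mul ((hX 3).pow e)
      |>.mul ((hX 2).pow _)) ?_
    omega
  have := test_complex (pt dd rr) lam hl _ hG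
  rw [← this]
  refine Finset.sum_congr rfl fun i _ => ?_
  have hc := conj_of_pow _ (prot_pow i)
  have hc6 : (starRingEnd ℂ) (prot i) = prot i ^ 6 := by
    linear_combination prot i ^ 6 * hc - (starRingEnd ℂ) (prot i) * prot_pow i
  have er : ((prot i).re : ℂ) = (prot i + (starRingEnd ℂ) (prot i)) / 2 := by
    rw [Complex.add_conj]; push_cast; ring
  have ei : Complex.I * ((prot i).im : ℂ) = (prot i - (starRingEnd ℂ) (prot i)) / 2 := by
    rw [Complex.sub_conj]; push_cast; ring
  have e1 : (px dd rr i : ℂ) * ((prot i).re : ℂ) + Complex.I * ((px dd rr i : ℂ) * ((prot i).im : ℂ)) =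
      px dd rr i * prot i := by
    linear_combination (px dd rr i : ℂ) * (er + ei)
  have e2 : (px dd rr i : ℂ) * ((prot i).re : ℂ) - Complex.I * ((px dd rr i : ℂ) * ((prot i).im : ℂ)) =
      px dd rr i * prot i ^ 6 := by
    linear_combination (px dd rr i : ℂ) * (er - ei + hc6)
  simp only [map_mul, map_pow, map_add, map_sub, eval_X, eval_C]
  simp [cvec, pt]
  left
  rw [e1, e2]
  ring

theorem hind0 {dd rr} (h : RootData dd rr) (lam : Idx → ℝ)
    (hl : ∀ G : MvPolynomial (Fin 4) ℝ, G.IsHomogeneous 7 → ∑ i, lam i * eval (pt dd rr i) G = 0) :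
    lam = 0 := by
  have key : ∀ (m a b e : ℕ), a + b + e ≤ 7 → (a + 6 * b) % 7 = m →
      (lam none : ℂ) * 0 ^ (a + b + e) + ∑ κ, (∑ j : Fin 7, (lam (some (j, κ)) : ℂ) * (zeta ^ (j : ℕ)) ^ m) *
        ((kx dd rr κ : ℂ) ^ (a + b) * (kw dd rr κ : ℂ) ^ e) = 0 := by
    intro m a b e h1 h2
    refine Eq.trans ?_ (test_ab lam hl a b e h1)
    rw [Fintype.sum_option, Fintype.sum_prod_type_right]
    have hp : ∀ i : Idx, prot i ^ (a + 6 * b) = prot i ^ m := fun i => by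
      rw [← h2]
      conv_lhs => rw [← Nat.div_add_mod (a + 6 * b) 7, pow_add, pow_mul, prot_pow, one_pow, one_mul]
    simp only [hp]
    congr 1
    · simp [px, pw, prot, pow_add]
    · refine Finset.sum_congr rfl fun κ _ => ?_
      rw [Finset.sum_mul]
      refine Finset.sum_congr rfl fun j _ => ?_
      simp only [px, pw, prot]
      ring
  have hm : ∀ m : Fin 4, (∀ κ, ∑ j : Fin 7, (lam (some (j, κ)) : ℂ) * (zeta ^ (j : ℕ)) ^ (m : ℕ) = 0) ∧
      ((m : ℕ) = 0 → (lam none : ℂ) = 0) := by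
    intro m
    have := indep h m (fun κ => ∑ j : Fin 7, (lam (some (j, κ)) : ℂ) * (zeta ^ (j : ℕ)) ^ (m : ℕ))
      (lam none : ℂ) (by
        intro r hr
        by_cases h0 : cidx r = 0
        · have hm0 := hr.resolve_left (fun h => h h0)
          rw [cidx_zero r h0, chk_row0]
          exact key m 0 0 0 (by norm_num) (by simp [hm0])
        · have hc := chk_row m r h0
          exact key m _ _ _ hc.2.1 hc.1)
    exact ⟨fun κ => congrFun this.1 κ, this.2⟩
  have hm' : ∀ m : Fin 4, (m : ℕ) ≠ 0 →
      (∀ κ, ∑ j : Fin 7, (lam (some (j, κ)) : ℂ) * (zeta ^ (j : ℕ)) ^ (7 - (m : ℕ)) = 0) := by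
    intro m hm0
    have := indep h m (fun κ => ∑ j : Fin 7, (lam (some (j, κ)) : ℂ) * (zeta ^ (j : ℕ)) ^ (7 - (m : ℕ)))
      (lam none : ℂ) (by
        intro r hr
        have h0 := hr.resolve_right hm0
        have hc := chk_row m r h0
        have := key (7 - m) (row m r).2.1 (row m r).1 (row m r).2.2 (by omega) (by omega)
        rwa [add_comm (row m r).2.1] at this)
    exact fun κ => congrFun this.1 κ
  have hinj : Function.Injective fun j : Fin 7 => zeta ^ (j : ℕ) := fun a b hab =>
    Fin.ext (zeta_prim.pow_inj a.2 b.2 hab)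
  ext i
  rcases i with _ | ⟨j, κ⟩
  · have := (hm 0).2 rfl
    exact_mod_cast this
  · have := Matrix.eq_zero_of_forall_pow_sum_mul_pow_eq_zero
      (v := fun j : Fin 7 => (lam (some (j, κ)) : ℂ)) hinj (by
        intro i
        fin_cases i
        · exact (hm 0).1 κ
        · exact (hm 1).1 κ
        · exact (hm 2).1 κ
        · exact (hm 3).1 κ
        · exact hm' 3 (by decide) κ
        · exact hm' 2 (by decide) κ
        · exact hm' 1 (by decide) κ)
    have := congrFun this j
    simpa using this

end

/-- For every k with 0 ≤ k ≤ 99 there is a real homogeneous septic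
F ∈ ℝ[x,y,z,w] whose surface {F = 0} ⊂ ℙ³(ℂ) has exactly k singular points, all
nodes, all real. -/
theorem exists_real_septic_with_k_real_nodes (k : ℕ) (hk : k ≤ 99) :
    ∃ F : MvPolynomial (Fin 4) ℝ, F.IsHomogeneous 7 ∧
      {p : Projectivization ℂ (Fin 4 → ℂ) |
          IsSingularPoint (MvPolynomial.map (algebraMap ℝ ℂ) F) p}.ncard = k ∧
      (∀ p : Projectivization ℂ (Fin 4 → ℂ),
        IsSingularPoint (MvPolynomial.map (algebraMap ℝ ℂ) F) p →
          IsNode (MvPolynomial.map (algebraMap ℝ ℂ) F) p) ∧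
      (∀ p : Projectivization ℂ (Fin 4 → ℂ),
        IsSingularPoint (MvPolynomial.map (algebraMap ℝ ℂ) F) p →
          IsRealPoint p) := by
  obtain ⟨dd, rr, h⟩ := exists_rootData
  have hcard : (Finset.univ : Finset Idx).card = 99 := by
    rw [Finset.card_univ]
    simp
  obtain ⟨S, -, hS⟩ := Finset.exists_subset_card_eq (s := (Finset.univ : Finset Idx)) (n := k)
    (by rw [hcard]; exact hk)
  have := partA (F0 ℝ) (pt dd rr) F0_hom (fun i => rfl)
    (fun i j => good_sing (pgood h i) (rot_of_pow _ (prot_pow i)) j)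
    (fun i u hu => good_node (pgood h i) (rot_of_pow _ (prot_pow i)) u hu)
    (fun v hv0 hv => hall0 h v hv0 (by rw [F0_map] at hv; exact hv))
    (hind0 h) S
  rw [hS] at this
  exact this
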